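/- arXiv:1911.11133 — 6 statements merged into one kernel-verified Lean document; each statement's English description precedes it below -/
import Mathlib

section
/- Let {α_n}_{n≥1} be a family of Dirichlet convolution polynomials, let N ≥ 2 be an integer and x ∈ ℂ. Then there exist θ ∈ ℝ and complex coefficients (c_m)_{m≥N+1} such that the Dirichlet series ∑_{m≥N+1} c_m m^{−s} converges absolutely for Re(s) > θ and, for all s ∈ ℂ with Re(s) > θ, exp( x · ∑_{n=2}^{N} α̂_n(0) n^{−s} ) = ∑_{n=1}^{N} α_n(x) n^{−s} + ∑_{m≥N+1} c_m m^{−s}. -/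
/-- A family of Dirichlet convolution polynomials: `α 1` is the constant polynomial `1`
and for all `n ≥ 1` and all complex `x, y`,
`α n (x+y) = ∑_{d ∣ n} α d (x) · α (n/d) (y)`. -/
def IsDirichletConvPolyFamily (α : ℕ → Polynomial ℂ) : Prop :=
  α 1 = 1 ∧ ∀ n : ℕ, 1 ≤ n → ∀ x y : ℂ,
    (α n).eval (x + y) = ∑ d ∈ n.divisors, (α d).eval x * (α (n / d)).eval y

open scoped LSeries.notation in
lemma aux_pow_hasSum (A : ArithmeticFunction ℂ) (s : ℂ) (hA : LSeriesSummable (fun n => A n) s)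
    (k : ℕ) : LSeriesHasSum (fun n => (A ^ k) n) s ((LSeries (fun n => A n) s) ^ k) := by
  induction k with
  | zero =>
    have h := ArithmeticFunction.one_eq_delta
    simp only [pow_zero]
    rw [h]
    unfold LSeriesHasSum
    have : LSeries.term LSeries.delta s = fun n => if n = 1 then 1 else 0 := by
      ext n; exact LSeries.term_delta s n
    rw [this]
    exact hasSum_ite_eq 1 1
  | succ k ih =>
    rw [pow_succ, pow_succ]
    exact ArithmeticFunction.LSeriesHasSum_mul ih hA.LSeriesHasSum

lemma aux_norm_pow_le (B : ArithmeticFunction ℂ) (R : ArithmeticFunction ℝ)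
    (hR : ∀ n, ‖B n‖ ≤ R n) (k n : ℕ) : ‖(B ^ k) n‖ ≤ (R ^ k) n := by
  induction k generalizing n with
  | zero => 
    simp only [pow_zero, ArithmeticFunction.one_apply]
    split_ifs <;> simp
  | succ k ih =>
    rw [pow_succ, pow_succ, ArithmeticFunction.mul_apply, ArithmeticFunction.mul_apply]
    refine (norm_sum_le _ _).trans (Finset.sum_le_sum fun p _ => ?_)
    rw [norm_mul]
    exact mul_le_mul (ih _) (hR _) (norm_nonneg _) ((norm_nonneg _).trans (ih _))

lemma aux_cast_pow (A : ArithmeticFunction ℂ) (R : ArithmeticFunction ℝ)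
    (hR : ∀ n, A n = (R n : ℂ)) (k n : ℕ) : (A ^ k) n = ((R ^ k) n : ℂ) := by
  induction k generalizing n with
  | zero => 
    simp only [pow_zero, ArithmeticFunction.one_apply]
    split_ifs <;> simp
  | succ k ih =>
    rw [pow_succ, pow_succ, ArithmeticFunction.mul_apply, ArithmeticFunction.mul_apply]
    push_cast
    exact Finset.sum_congr rfl fun p _ => by rw [ih, hR]

lemma aux_row (B : ArithmeticFunction ℂ) (s : ℂ) (hB : LSeriesSummable (fun n => B n) s) :
    ∃ T : ℝ, 0 ≤ T ∧ ∀ k, ∑' n, ‖LSeries.term (fun n => (B ^ k) n) s n‖ ≤ T ^ k := by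
  let R : ArithmeticFunction ℝ := ⟨fun n => ‖B n‖, by simp⟩
  let A : ArithmeticFunction ℂ := ⟨fun n => ((‖B n‖ : ℝ) : ℂ), by simp⟩
  have hRB : ∀ n, ‖B n‖ ≤ R n := fun n => le_rfl
  have hAR : ∀ n, A n = (R n : ℂ) := fun n => rfl
  have hA : LSeriesSummable (fun n => A n) (s.re : ℂ) := by
    have h1 : LSeriesSummable (fun n => B n) (s.re : ℂ) :=
      (LSeriesSummable_iff_of_re_eq_re (by simp)).1 hB
    refine Summable.of_norm_bounded h1.norm fun n => LSeries.norm_term_le _ ?_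
    rw [hAR]
    simp [R]
  refine ⟨‖LSeries (fun n => A n) s.re‖, norm_nonneg _, fun k => ?_⟩
  have h := Complex.hasSum_re (aux_pow_hasSum A s.re hA k)
  have key : ∀ n, ‖LSeries.term (fun n => (B ^ k) n) s n‖ ≤
      (LSeries.term (fun n => (A ^ k) n) (s.re : ℂ) n).re := by
    intro n
    rw [LSeries.norm_term_eq, LSeries.term_def]
    split_ifs with hn
    · simp
    · rw [aux_cast_pow A R hAR, show (n : ℂ) = ((n : ℝ) : ℂ) by simp,
        ← Complex.ofReal_cpow (by positivity), ← Complex.ofReal_div, Complex.ofReal_re]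
      gcongr
      exact aux_norm_pow_le B R hRB k n
  have hs : Summable fun n => ‖LSeries.term (fun n => (B ^ k) n) s n‖ :=
    (aux_pow_hasSum B s hB k).summable.norm
  calc _ ≤ _ := hs.tsum_le_tsum key h.summable
    _ = _ := h.tsum_eq
    _ ≤ _ := (Complex.re_le_norm _).trans (norm_pow _ _).le

/-- Coefficients of `exp (x B)`. -/
noncomputable def auxE (B : ArithmeticFunction ℂ) (x : ℂ) (n : ℕ) : ℂ :=
  ∑' k : ℕ, x ^ k / (Nat.factorial k : ℂ) * (B ^ k) n

lemma aux_exp (B : ArithmeticFunction ℂ) (x s : ℂ) (hB : LSeriesSummable (fun n => B n) s) :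
    (Summable fun n : ℕ => ‖auxE B x n * (n : ℂ) ^ (-s)‖) ∧
    Complex.exp (x * LSeries (fun n => B n) s) = ∑' n : ℕ, auxE B x n * (n : ℂ) ^ (-s) := by
  obtain ⟨T, hT, hrow⟩ := aux_row B s hB
  let F : ℕ × ℕ → ℂ := fun p => x ^ p.1 / (Nat.factorial p.1 : ℂ) *
    LSeries.term (fun n => (B ^ p.1) n) s p.2
  have hFn : Summable fun p => ‖F p‖ := by
    refine (summable_prod_of_nonneg fun p => norm_nonneg _).2 ⟨fun k => ?_, ?_⟩
    · simp only [F, norm_mul]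
      exact (aux_pow_hasSum B s hB k).summable.norm.mul_left _
    · refine Summable.of_nonneg_of_le (fun k => tsum_nonneg fun n => norm_nonneg _) (fun k => ?_)
        (Real.summable_pow_div_factorial (‖x‖ * T))
      simp only [F, norm_mul]
      rw [tsum_mul_left, mul_pow, norm_div, norm_pow, Complex.norm_natCast, mul_div_right_comm]
      gcongr
      exact hrow k
  have hF : Summable F := hFn.of_norm
  have hcol : ∀ n, ∑' k, F (k, n) = auxE B x n * (n : ℂ) ^ (-s) := by
    intro n
    rw [auxE, ← tsum_mul_right]
    refine tsum_congr fun k => ?_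
    simp only [F]
    rw [LSeries.term_def₀ (by simp), mul_assoc]
  have hswap : Summable fun p : ℕ × ℕ => ‖F p.swap‖ := (Equiv.prodComm ℕ ℕ).summable_iff.2 hFn
  constructor
  · refine Summable.of_nonneg_of_le (fun _ => norm_nonneg _) (fun n => ?_) hswap.prod
    rw [← hcol]
    exact norm_tsum_le_tsum_norm (hswap.prod_factor n)
  · simp_rw [← hcol]
    have hcomm : ∑' n, ∑' k, F (k, n) = ∑' k, ∑' n, F (k, n) :=
      Summable.tsum_comm (f := fun k n => F (k, n)) hF
    rw [hcomm, Complex.exp_eq_exp_ℂ, NormedSpace.exp_eq_tsum_div]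
    refine tsum_congr fun k => ?_
    simp only [F]
    rw [tsum_mul_left, (aux_pow_hasSum B s hB k).tsum_eq, mul_pow, mul_div_right_comm]

lemma aux_deriv (α : ℕ → Polynomial ℂ) (hα : IsDirichletConvPolyFamily α) (n : ℕ) (hn : 1 ≤ n) :
    Polynomial.derivative (α n) =
      ∑ d ∈ n.divisors, α d * Polynomial.C ((α (n / d)).coeff 1) := by
  refine Polynomial.funext fun x => ?_
  have h : (α n).comp (Polynomial.C x + Polynomial.X) =
      ∑ d ∈ n.divisors, Polynomial.C ((α d).eval x) * α (n / d) := by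
    refine Polynomial.funext fun y => ?_
    simp [Polynomial.eval_finsetSum, hα.2 n hn x y]
  have h2 := congrArg (fun p => (Polynomial.derivative p).eval 0) h
  simp only [Polynomial.derivative_comp, Polynomial.derivative_sum, Polynomial.eval_finsetSum] at h2
  simp [Polynomial.eval_comp] at h2
  rw [h2, Polynomial.eval_finsetSum]
  refine Finset.sum_congr rfl fun d _ => ?_
  simp [← Polynomial.coeff_zero_eq_eval_zero, Polynomial.coeff_derivative]

lemma aux_coeff (α : ℕ → Polynomial ℂ) (hα : IsDirichletConvPolyFamily α)
    (h0 : ∀ n, 2 ≤ n → (α n).coeff 0 = 0) (N : ℕ) (B : ArithmeticFunction ℂ)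
    (hB : ∀ n, 1 ≤ n → n ≤ N → B n = (α n).coeff 1) (k n : ℕ) (hn : 1 ≤ n) (hnN : n ≤ N) :
    (B ^ k) n = (Nat.factorial k : ℂ) * (α n).coeff k := by
  induction k generalizing n with
  | zero =>
    rcases eq_or_lt_of_le hn with rfl | h
    · simp [hα.1]
    · have : n ≠ 1 := by omega
      simp [h0 n h, this]
  | succ k ih =>
    have h := congrArg (fun p => Polynomial.coeff p k) (aux_deriv α hα n hn)
    simp only [Polynomial.coeff_derivative, Polynomial.finsetSum_coeff,
      Polynomial.coeff_mul_C] at h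
    rw [pow_succ, ArithmeticFunction.mul_apply, Nat.factorial_succ]
    push_cast
    rw [show ((k : ℂ) + 1) * (Nat.factorial k : ℂ) * (α n).coeff (k + 1) =
      (Nat.factorial k : ℂ) * ((α n).coeff (k + 1) * ((k : ℂ) + 1)) by ring, h, Finset.mul_sum,
      Nat.sum_divisorsAntidiagonal (f := fun a b => (B ^ k) a * B b)]
    refine Finset.sum_congr rfl fun d hd => ?_
    have hdn := Nat.dvd_of_mem_divisors hd
    have hd1 : 1 ≤ d := Nat.pos_of_mem_divisors hd
    have hd2 : d ≤ n := Nat.divisor_le hd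
    rw [ih d hd1 (hd2.trans hnN), hB (n / d) (Nat.div_pos hd2 hd1)
      ((Nat.div_le_self _ _).trans hnN)]
    ring

theorem stmt_4 (α : ℕ → Polynomial ℂ) (hα : IsDirichletConvPolyFamily α)
    (αhat : ℕ → Polynomial ℂ)
    (hhat : ∀ n : ℕ, 2 ≤ n → Polynomial.X * αhat n = α n)
    (N : ℕ) (hN : 2 ≤ N) (x : ℂ) :
    ∃ (θ : ℝ) (c : ℕ → ℂ),
      (∀ m : ℕ, m ≤ N → c m = 0) ∧
      (∀ s : ℂ, θ < s.re → Summable fun m : ℕ => ‖c m * (m : ℂ) ^ (-s)‖) ∧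
      (∀ s : ℂ, θ < s.re →
        Complex.exp (x * ∑ n ∈ Finset.Icc 2 N, (αhat n).eval 0 * (n : ℂ) ^ (-s)) =
          (∑ n ∈ Finset.Icc 1 N, (α n).eval x * (n : ℂ) ^ (-s)) +
            ∑' m : ℕ, c m * (m : ℂ) ^ (-s)) := by
  have hcoeff1 : ∀ n, 2 ≤ n → (α n).coeff 1 = (αhat n).eval 0 := by
    intro n hn
    rw [← hhat n hn, Polynomial.coeff_X_mul, Polynomial.coeff_zero_eq_eval_zero]
  have h0 : ∀ n, 2 ≤ n → (α n).coeff 0 = 0 := by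
    intro n hn
    rw [← hhat n hn, Polynomial.coeff_X_mul_zero]
  let B : ArithmeticFunction ℂ :=
    ⟨fun n => if n ∈ Finset.Icc 2 N then (αhat n).eval 0 else 0, by simp⟩
  have hBdef : ∀ n, B n = if n ∈ Finset.Icc 2 N then (αhat n).eval 0 else 0 := fun _ => rfl
  have hB : ∀ n, 1 ≤ n → n ≤ N → B n = (α n).coeff 1 := by
    intro n hn hnN
    rw [hBdef]
    rcases eq_or_lt_of_le hn with rfl | h
    · simp [hα.1, Polynomial.coeff_one]
    · rw [if_pos (Finset.mem_Icc.2 ⟨h, hnN⟩), hcoeff1 n h]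
  have hterm : ∀ s n, n ∉ Finset.Icc 2 N → LSeries.term (fun n => B n) s n = 0 := by
    intro s n hn
    rw [LSeries.term_def₀ (by simp), hBdef, if_neg hn, zero_mul]
  have hsum : ∀ s, LSeriesSummable (fun n => B n) s := fun s =>
    summable_of_ne_finset_zero (hterm s)
  have hL : ∀ s, LSeries (fun n => B n) s =
      ∑ n ∈ Finset.Icc 2 N, (αhat n).eval 0 * (n : ℂ) ^ (-s) := by
    intro s
    rw [LSeries, tsum_eq_sum (hterm s)]
    refine Finset.sum_congr rfl fun n hn => ?_
    rw [LSeries.term_def₀ (by simp), hBdef, if_pos hn]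
  have hE : ∀ n, 1 ≤ n → n ≤ N → auxE B x n = (α n).eval x := by
    intro n hn hnN
    rw [auxE, Polynomial.eval_eq_sum_range, tsum_eq_sum (s := Finset.range ((α n).natDegree + 1))]
    · refine Finset.sum_congr rfl fun k _ => ?_
      rw [aux_coeff α hα h0 N B hB k n hn hnN]
      have := Nat.factorial_ne_zero k
      field_simp
    · intro k hk
      rw [aux_coeff α hα h0 N B hB k n hn hnN, Polynomial.coeff_eq_zero_of_natDegree_lt]
      · simp
      · simpa [Nat.lt_succ_iff] using hk
  have hE0 : auxE B x 0 = 0 := by simp [auxE]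
  refine ⟨0, fun m => if m ≤ N then 0 else auxE B x m, fun m hm => if_pos hm, ?_, ?_⟩
  · intro s _
    refine Summable.of_nonneg_of_le (fun _ => norm_nonneg _) (fun n => ?_)
      (aux_exp B x s (hsum s)).1
    beta_reduce
    split_ifs
    · rw [zero_mul, norm_zero]; exact norm_nonneg _
    · exact le_rfl
  · intro s _
    obtain ⟨h1, h2⟩ := aux_exp B x s (hsum s)
    rw [← hL, h2]
    have hc : Summable fun m : ℕ => (if m ≤ N then 0 else auxE B x m) * (m : ℂ) ^ (-s) := by
      refine Summable.of_norm_bounded h1 (fun n => ?_)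
      split_ifs
      · rw [zero_mul, norm_zero]; exact norm_nonneg _
      · exact le_rfl
    have hz : ∀ n ∉ Finset.Icc 1 N,
        (if n ∈ Finset.Icc 1 N then (α n).eval x * (n : ℂ) ^ (-s) else 0) = 0 :=
      fun n hn => if_neg hn
    have e1 : ∑ n ∈ Finset.Icc 1 N, (α n).eval x * (n : ℂ) ^ (-s) =
        ∑' n, if n ∈ Finset.Icc 1 N then (α n).eval x * (n : ℂ) ^ (-s) else 0 := by
      rw [tsum_eq_sum hz]
      exact Finset.sum_congr rfl fun n hn => (if_pos hn).symm
    rw [e1, ← (summable_of_ne_finset_zero hz).tsum_add hc]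
    refine tsum_congr fun n => ?_
    by_cases hn : n ≤ N
    · rcases Nat.eq_zero_or_pos n with rfl | hp
      · simp [hE0]
      · rw [if_pos (Finset.mem_Icc.2 ⟨hp, hn⟩), if_pos hn, hE n hp hn]
        simp
    · rw [if_neg (by simp [hn]), if_neg hn, zero_add]
end

section
/- Let {α_n}_{n≥1} and {β_n}_{n≥1} be families of Dirichlet convolution polynomials. Then the polynomials γ_n(x) := ∑_{d∣n} α_d(x)·β_{n/d}(x), n ≥ 1, also form a family of Dirichlet convolution polynomials. -/
/-- The arithmetic function `n ↦ α n (x)`. -/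
noncomputable def evalAF (α : ℕ → Polynomial ℂ) (x : ℂ) : ArithmeticFunction ℂ :=
  ⟨fun n => if n = 0 then 0 else (α n).eval x, by simp⟩

theorem evalAF_apply (α : ℕ → Polynomial ℂ) (x : ℂ) {n : ℕ} (hn : n ≠ 0) :
    evalAF α x n = (α n).eval x := by
  change (if n = 0 then 0 else (α n).eval x) = _
  simp [hn]

theorem evalAF_mul (α β : ℕ → Polynomial ℂ) (x y : ℂ) (n : ℕ) :
    (evalAF α x * evalAF β y) n
      = ∑ d ∈ n.divisors, (α d).eval x * (β (n / d)).eval y := by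
  rw [ArithmeticFunction.mul_apply,
    Nat.sum_divisorsAntidiagonal (fun a b => evalAF α x a * evalAF β y b)]
  refine Finset.sum_congr rfl fun d hd => ?_
  have hd' := Nat.mem_divisors.1 hd
  have h1 : d ≠ 0 := ne_zero_of_dvd_ne_zero hd'.2 hd'.1
  have h2 : n / d ≠ 0 := ne_zero_of_dvd_ne_zero hd'.2 (Nat.div_dvd_of_dvd hd'.1)
  rw [evalAF_apply α x h1, evalAF_apply β y h2]

theorem evalAF_add (α : ℕ → Polynomial ℂ) (hα : IsDirichletConvPolyFamily α) (x y : ℂ) :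
    evalAF α (x + y) = evalAF α x * evalAF α y := by
  ext n
  rcases Nat.eq_zero_or_pos n with rfl | hn
  · simp
  · rw [evalAF_mul, evalAF_apply _ _ hn.ne', hα.2 n hn]

theorem evalAF_conv (α β : ℕ → Polynomial ℂ) (x : ℂ) :
    evalAF (fun n => ∑ d ∈ n.divisors, α d * β (n / d)) x = evalAF α x * evalAF β x := by
  ext n
  rcases Nat.eq_zero_or_pos n with rfl | hn
  · simp
  · rw [evalAF_mul, evalAF_apply _ _ hn.ne', Polynomial.eval_finset_sum]
    simp only [Polynomial.eval_mul]

theorem stmt_9 (α β : ℕ → Polynomial ℂ)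
    (hα : IsDirichletConvPolyFamily α) (hβ : IsDirichletConvPolyFamily β) :
    IsDirichletConvPolyFamily (fun n => ∑ d ∈ n.divisors, α d * β (n / d)) := by
  refine ⟨by simp [hα.1, hβ.1], fun n hn x y => ?_⟩
  rw [← evalAF_apply (fun n => ∑ d ∈ n.divisors, α d * β (n / d)) (x + y)
    (Nat.one_le_iff_ne_zero.1 hn)]
  rw [← evalAF_mul (fun n => ∑ d ∈ n.divisors, α d * β (n / d))
    (fun n => ∑ d ∈ n.divisors, α d * β (n / d)) x y n]
  rw [evalAF_conv, evalAF_conv, evalAF_conv, evalAF_add α hα, evalAF_add β hβ,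
    mul_mul_mul_comm]
end

section
/- Let f(s) = ∑_{n≥2} c_n n^{−s} be a Dirichlet series with complex coefficients and zero constant term that converges absolutely in some half-plane ℂ_θ = {s ∈ ℂ : Re(s) > θ}. Then there exists a Dirichlet series g(s) = ∑_{n≥2} b_n n^{−s} with zero constant term, converging absolutely in some half-plane, such that f(s + g(s)) = g(s) for all s with Re(s) sufficiently large; moreover g is unique, i.e. if g̃(s) = ∑_{n≥2} b̃_n n^{−s} is another Dirichlet series with zero constant term, absolutely convergent in some half-plane, satisfying f(s + g̃(s)) = g̃(s) for all Re(s) sufficiently large, then b̃_n = b_n for all n. -/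
/-- The Dirichlet series `∑_{n} c n · n^{-s}` (as a `tsum`). -/
noncomputable def DSeries (c : ℕ → ℂ) (s : ℂ) : ℂ :=
  ∑' n : ℕ, c n * (n : ℂ) ^ (-s)

/-- `c` is the coefficient sequence of a Dirichlet series with zero constant term that
converges absolutely in some half-plane. -/
def IsD0 (c : ℕ → ℂ) : Prop :=
  c 0 = 0 ∧ c 1 = 0 ∧
    ∃ θ : ℝ, ∀ s : ℂ, θ < s.re → Summable fun n : ℕ => ‖c n * (n : ℂ) ^ (-s)‖

open scoped ENNReal

lemma fib (e : ℕ → ℕ → ℂ) (h0 : ∀ k, e 0 k = 0) (h0' : ∀ n, e n 0 = 0) (s : ℂ) (m : ℕ) :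
    (∑ p ∈ m.divisorsAntidiagonal, e p.1 p.2) * (m : ℂ) ^ (-s) =
      ∑' b : (fun p : ℕ × ℕ ↦ p.1 * p.2) ⁻¹' {m},
        e b.val.1 b.val.2 * ((b.val.1 : ℂ) ^ (-s) * (b.val.2 : ℂ) ^ (-s)) := by
  rcases eq_or_ne m 0 with rfl | hn
  · have : ∀ b : (fun p : ℕ × ℕ ↦ p.1 * p.2) ⁻¹' {0},
        e b.val.1 b.val.2 * ((b.val.1 : ℂ) ^ (-s) * (b.val.2 : ℂ) ^ (-s)) = 0 := by
      rintro ⟨⟨a, b⟩, hp⟩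
      have hp' : a * b = 0 := hp
      rcases mul_eq_zero.mp hp' with rfl | rfl <;> simp [h0, h0']
    rw [tsum_congr this]
    simp
  rw [show (fun p : ℕ × ℕ ↦ p.1 * p.2) ⁻¹' {m} = m.divisorsAntidiagonal by ext; simp [hn],
    Finset.tsum_subtype' m.divisorsAntidiagonal
      fun p ↦ e p.1 p.2 * ((p.1 : ℂ) ^ (-s) * (p.2 : ℂ) ^ (-s)), Finset.sum_mul]
  refine Finset.sum_congr rfl fun p hp ↦ ?_
  rw [← Complex.natCast_mul_natCast_cpow, ← Nat.cast_mul, (Nat.mem_divisorsAntidiagonal.mp hp).1]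

lemma fibN (e : ℕ → ℕ → ℂ) (h0 : ∀ k, e 0 k = 0) (h0' : ∀ n, e n 0 = 0) (s : ℂ) :
    ∑' m : ℕ, ‖(∑ p ∈ m.divisorsAntidiagonal, e p.1 p.2) * (m : ℂ) ^ (-s)‖ₑ ≤
      ∑' n : ℕ, ∑' k : ℕ, ‖e n k * ((n : ℂ) ^ (-s) * (k : ℂ) ^ (-s))‖ₑ := by
  rw [← ENNReal.tsum_prod (f := fun n k : ℕ => ‖e n k * ((n : ℂ) ^ (-s) * (k : ℂ) ^ (-s))‖ₑ),
    ← ENNReal.tsum_fiberwise _ (fun p : ℕ × ℕ ↦ p.1 * p.2)]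
  refine ENNReal.tsum_le_tsum fun m => ?_
  rw [fib e h0 h0']
  exact enorm_tsum_le_tsum_enorm

lemma fibD (e : ℕ → ℕ → ℂ) (h0 : ∀ k, e 0 k = 0) (h0' : ∀ n, e n 0 = 0) (s : ℂ)
    (h : ∑' n : ℕ, ∑' k : ℕ, ‖e n k * ((n : ℂ) ^ (-s) * (k : ℂ) ^ (-s))‖ₑ ≠ ⊤) :
    ∑' m : ℕ, (∑ p ∈ m.divisorsAntidiagonal, e p.1 p.2) * (m : ℂ) ^ (-s) =
      ∑' n : ℕ, ∑' k : ℕ, e n k * ((n : ℂ) ^ (-s) * (k : ℂ) ^ (-s)) := by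
  rw [← ENNReal.tsum_prod (f := fun n k : ℕ => ‖e n k * ((n : ℂ) ^ (-s) * (k : ℂ) ^ (-s))‖ₑ)] at h
  have hs : Summable (fun p : ℕ × ℕ => e p.1 p.2 * ((p.1 : ℂ) ^ (-s) * (p.2 : ℂ) ^ (-s))) :=
    Summable.of_enorm h
  rw [← hs.tsum_prod, ← (hs.hasSum.tsum_fiberwise (fun p : ℕ × ℕ ↦ p.1 * p.2)).tsum_eq]
  exact tsum_congr fun m => fib e h0 h0' s m

/-- weighted ℓ¹ norm -/
noncomputable def NN (s : ℂ) (a : ℕ → ℂ) : ℝ≥0∞ := ∑' n : ℕ, ‖a n * (n : ℂ) ^ (-s)‖ₑ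

lemma NN_ne_top {s : ℂ} {a : ℕ → ℂ} :
    NN s a ≠ ⊤ ↔ Summable fun n : ℕ => ‖a n * (n : ℂ) ^ (-s)‖ :=
  tsum_enorm_ne_top_iff_summable_norm

lemma aux_mul (s x y : ℂ) (n k : ℕ) : x * y * ((n : ℂ) ^ (-s) * (k : ℂ) ^ (-s)) =
    (x * (n : ℂ) ^ (-s)) * (y * (k : ℂ) ^ (-s)) := by ring

lemma NN_prod (s : ℂ) (a b : ℕ → ℂ) :
    ∑' n : ℕ, ∑' k : ℕ, ‖a n * b k * ((n : ℂ) ^ (-s) * (k : ℂ) ^ (-s))‖ₑ = NN s a * NN s b := by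
  simp only [aux_mul, enorm_mul _ (_ * _), ENNReal.tsum_mul_left, ENNReal.tsum_mul_right, NN]

lemma NN_mul (s : ℂ) (a b : ArithmeticFunction ℂ) : NN s (a * b : ArithmeticFunction ℂ) ≤ NN s a * NN s b := by
  rw [← NN_prod]
  simpa [NN, ArithmeticFunction.mul_apply] using fibN (fun n k => a n * b k) (by simp) (by simp) s

lemma DS_mul (s : ℂ) (a b : ArithmeticFunction ℂ) (ha : NN s a ≠ ⊤) (hb : NN s b ≠ ⊤) :
    DSeries (a * b : ArithmeticFunction ℂ) s = DSeries a s * DSeries b s := by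
  have := fibD (fun n k => a n * b k) (by simp) (by simp) s
    (by rw [NN_prod]; exact ENNReal.mul_ne_top ha hb)
  simp only [DSeries, ArithmeticFunction.mul_apply]
  rw [this]
  simp only [aux_mul, tsum_mul_left, tsum_mul_right]

lemma one_term (s : ℂ) (n : ℕ) :
    (1 : ArithmeticFunction ℂ) n * (n : ℂ) ^ (-s) = if n = 1 then 1 else 0 := by
  rw [ArithmeticFunction.one_apply]
  split_ifs with h <;> simp [h]

lemma NN_one (s : ℂ) : NN s (1 : ArithmeticFunction ℂ) = 1 := by
  simp only [NN, one_term]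
  rw [tsum_eq_single 1] <;> simp +contextual

lemma DS_one (s : ℂ) : DSeries (1 : ArithmeticFunction ℂ) s = 1 := by
  simp only [DSeries, one_term]
  simp

lemma NN_pow (s : ℂ) (a : ArithmeticFunction ℂ) (j : ℕ) :
    NN s (a ^ j : ArithmeticFunction ℂ) ≤ NN s a ^ j := by
  induction j with
  | zero => simp [NN_one]
  | succ j ih =>
    rw [pow_succ, pow_succ]
    exact (NN_mul _ _ _).trans (by gcongr)

lemma DS_pow (s : ℂ) (a : ArithmeticFunction ℂ) (ha : NN s a ≠ ⊤) (j : ℕ) :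
    DSeries (a ^ j : ArithmeticFunction ℂ) s = DSeries a s ^ j := by
  induction j with
  | zero => simp [DS_one]
  | succ j ih =>
    rw [pow_succ, pow_succ, DS_mul _ _ _ _ ha, ih]
    exact ne_top_of_le_ne_top (ENNReal.pow_ne_top ha) (NN_pow s a j)

/-- coefficients of `n ^ (- g)` -/
noncomputable def EE (b : ArithmeticFunction ℂ) (n k : ℕ) : ℂ :=
  ∑' j : ℕ, ((-(Real.log n : ℂ)) ^ j / (j.factorial : ℂ)) * (b ^ j) k

lemma EE_zero (b : ArithmeticFunction ℂ) (n : ℕ) : EE b n 0 = 0 := by simp [EE]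

lemma EE_dbl (b : ArithmeticFunction ℂ) (s : ℂ) (K : ℝ) (hK : 0 ≤ K) (n : ℕ)
    (hb : NN s b ≤ ENNReal.ofReal K) :
    ∑' j : ℕ, ∑' k : ℕ, ‖((-(Real.log n : ℂ)) ^ j / (j.factorial : ℂ)) * (b ^ j) k * (k : ℂ) ^ (-s)‖ₑ
      ≤ ENNReal.ofReal (Real.exp (Real.log n * K)) := by
  have hL : 0 ≤ Real.log n := Real.log_natCast_nonneg n
  have hx := NormedSpace.expSeries_div_hasSum_exp (𝔸 := ℝ) (Real.log n * K)
  rw [← Real.exp_eq_exp_ℝ] at hx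
  rw [← hx.tsum_eq, ENNReal.ofReal_tsum_of_nonneg (fun j => by positivity) hx.summable]
  refine ENNReal.tsum_le_tsum fun j => ?_
  simp only [mul_assoc, enorm_mul _ (_ * _), ENNReal.tsum_mul_left]
  have h1 : ‖(-(Real.log n : ℂ)) ^ j / (j.factorial : ℂ)‖ₑ =
      ENNReal.ofReal (Real.log n ^ j / j.factorial) := by
    rw [← ofReal_norm]
    congr 1
    rw [norm_div, norm_pow, norm_neg, Complex.norm_real, Real.norm_of_nonneg hL, Complex.norm_natCast]
  rw [h1, mul_pow, mul_div_right_comm, ENNReal.ofReal_mul (by positivity), ENNReal.ofReal_pow hK]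
  gcongr
  exact (NN_pow s b j).trans (by gcongr)

lemma EE_NN (b : ArithmeticFunction ℂ) (s : ℂ) (K : ℝ) (hK : 0 ≤ K) (n : ℕ)
    (hb : NN s b ≤ ENNReal.ofReal K) :
    NN s (EE b n) ≤ ENNReal.ofReal (Real.exp (Real.log n * K)) := by
  refine le_trans ?_ (EE_dbl b s K hK n hb)
  rw [ENNReal.tsum_comm]
  refine ENNReal.tsum_le_tsum fun k => ?_
  rw [EE, ← tsum_mul_right]
  exact enorm_tsum_le_tsum_enorm

lemma EE_DS (b : ArithmeticFunction ℂ) (s : ℂ) (K : ℝ) (hK : 0 ≤ K) (n : ℕ)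
    (hb : NN s b ≤ ENNReal.ofReal K) :
    DSeries (EE b n) s = Complex.exp (-(Real.log n : ℂ) * DSeries b s) := by
  have hd := ne_top_of_le_ne_top ENNReal.ofReal_ne_top (EE_dbl b s K hK n hb)
  rw [← ENNReal.tsum_prod (f := fun j k : ℕ => ‖((-(Real.log n : ℂ)) ^ j / (j.factorial : ℂ)) * (b ^ j) k * (k : ℂ) ^ (-s)‖ₑ)] at hd
  have hs := Summable.of_enorm hd
  have hbt : NN s b ≠ ⊤ := ne_top_of_le_ne_top ENNReal.ofReal_ne_top hb
  have hx := NormedSpace.expSeries_div_hasSum_exp (𝔸 := ℂ) (-(Real.log n : ℂ) * DSeries b s)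
  rw [← Complex.exp_eq_exp_ℂ] at hx
  have e1 : DSeries (EE b n) s = ∑' k : ℕ, ∑' j : ℕ,
      ((-(Real.log n : ℂ)) ^ j / (j.factorial : ℂ)) * (b ^ j) k * (k : ℂ) ^ (-s) := by
    rw [DSeries]
    refine tsum_congr fun k => ?_
    rw [EE, ← tsum_mul_right]
  have e2 : ∑' k : ℕ, ∑' j : ℕ,
      ((-(Real.log n : ℂ)) ^ j / (j.factorial : ℂ)) * (b ^ j) k * (k : ℂ) ^ (-s) =
      ∑' j : ℕ, ∑' k : ℕ,
      ((-(Real.log n : ℂ)) ^ j / (j.factorial : ℂ)) * (b ^ j) k * (k : ℂ) ^ (-s) :=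
    Summable.tsum_comm (f := fun j k : ℕ =>
      ((-(Real.log n : ℂ)) ^ j / (j.factorial : ℂ)) * (b ^ j) k * (k : ℂ) ^ (-s)) hs
  rw [e1, e2, ← hx.tsum_eq]
  refine tsum_congr fun j => ?_
  have e3 : ∑' k : ℕ, ((-(Real.log n : ℂ)) ^ j / (j.factorial : ℂ)) * (b ^ j) k * (k : ℂ) ^ (-s)
      = ((-(Real.log n : ℂ)) ^ j / (j.factorial : ℂ)) * DSeries (b ^ j : ArithmeticFunction ℂ) s := by
    rw [DSeries, ← tsum_mul_left]
    exact tsum_congr fun k => mul_assoc _ _ _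
  rw [e3, DS_pow s b hbt, mul_pow]
  ring

/-- the coefficients of `f (s + g s)` -/
noncomputable def Phi (c : ℕ → ℂ) (b : ArithmeticFunction ℂ) : ArithmeticFunction ℂ :=
  ⟨fun m => ∑ p ∈ m.divisorsAntidiagonal, c p.1 * EE b p.1 p.2, by simp⟩

lemma Phi_apply (c : ℕ → ℂ) (b : ArithmeticFunction ℂ) (m : ℕ) :
    Phi c b m = ∑ p ∈ m.divisorsAntidiagonal, c p.1 * EE b p.1 p.2 := rfl

lemma Phi_dbl (c : ℕ → ℂ) (hc : c 0 = 0) (b : ArithmeticFunction ℂ) (s : ℂ) (K : ℝ) (hK : 0 ≤ K)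
    (hb : NN s b ≤ ENNReal.ofReal K) :
    ∑' n : ℕ, ∑' k : ℕ, ‖c n * EE b n k * ((n : ℂ) ^ (-s) * (k : ℂ) ^ (-s))‖ₑ ≤ NN (s - K) c := by
  refine ENNReal.tsum_le_tsum fun n => ?_
  simp only [aux_mul, enorm_mul _ (_ * _), ENNReal.tsum_mul_left]
  rcases eq_or_ne n 0 with rfl | hn
  · simp [hc]
  have hn' : (0:ℝ) < n := by positivity
  have : ‖c n * (n : ℂ) ^ (-(s - K))‖ₑ =
      ‖c n * (n : ℂ) ^ (-s)‖ₑ * ENNReal.ofReal (Real.exp (Real.log n * K)) := by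
    rw [show -(s - K) = -s + (K : ℂ) by ring, Complex.cpow_add _ _ (by exact_mod_cast hn), ← mul_assoc,
      enorm_mul (_ * _)]
    congr 1
    rw [← ofReal_norm, ← Complex.ofReal_natCast, Complex.norm_cpow_eq_rpow_re_of_pos hn',
      Complex.ofReal_re, Real.rpow_def_of_pos hn']
  rw [this]
  gcongr
  exact EE_NN b s K hK n hb

lemma Phi_NN (c : ℕ → ℂ) (hc : c 0 = 0) (b : ArithmeticFunction ℂ) (s : ℂ) (K : ℝ) (hK : 0 ≤ K)
    (hb : NN s b ≤ ENNReal.ofReal K) : NN s (Phi c b) ≤ NN (s - K) c :=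
  (fibN (fun n k => c n * EE b n k) (by simp [hc]) (by simp [EE_zero]) s).trans
    (Phi_dbl c hc b s K hK hb)

lemma Phi_DS (c : ℕ → ℂ) (hc : c 0 = 0) (b : ArithmeticFunction ℂ) (s : ℂ) (K : ℝ) (hK : 0 ≤ K)
    (hb : NN s b ≤ ENNReal.ofReal K) (hcs : NN (s - K) c ≠ ⊤) :
    DSeries (Phi c b) s = DSeries c (s + DSeries b s) := by
  have := fibD (fun n k => c n * EE b n k) (by simp [hc]) (by simp [EE_zero]) s
    (ne_top_of_le_ne_top hcs (Phi_dbl c hc b s K hK hb))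
  refine this.trans ?_
  refine tsum_congr fun n => ?_
  simp only [aux_mul, tsum_mul_left]
  rw [← DSeries, EE_DS b s K hK n hb]
  rcases eq_or_ne n 0 with rfl | hn
  · simp [hc]
  have hn' : (n : ℂ) ≠ 0 := by exact_mod_cast hn
  rw [neg_add, Complex.cpow_add _ _ hn', mul_assoc]
  congr 2
  rw [Complex.cpow_def_of_ne_zero hn', Complex.natCast_log]
  congr 1
  ring

lemma pow_congr (a b : ArithmeticFunction ℂ) (m : ℕ) (h : ∀ k < m, a k = b k) (j : ℕ) :
    ∀ k < m, (a ^ j) k = (b ^ j) k := by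
  induction j with
  | zero => simp
  | succ j ih =>
    intro k hk
    rw [pow_succ, pow_succ, ArithmeticFunction.mul_apply, ArithmeticFunction.mul_apply]
    refine Finset.sum_congr rfl fun p hp => ?_
    have h1 := Nat.divisor_le (Nat.fst_mem_divisors_of_mem_antidiagonal hp)
    have h2 := Nat.divisor_le (Nat.snd_mem_divisors_of_mem_antidiagonal hp)
    rw [ih _ (by omega), h _ (by omega)]

lemma Phi_congr (c : ℕ → ℂ) (hc : c 1 = 0) (a b : ArithmeticFunction ℂ) (m : ℕ)
    (h : ∀ k < m, a k = b k) : Phi c a m = Phi c b m := by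
  rw [Phi_apply, Phi_apply]
  refine Finset.sum_congr rfl fun p hp => ?_
  obtain ⟨h1, h2⟩ := Nat.mem_divisorsAntidiagonal.mp hp
  have hp0 := Nat.pos_of_ne_zero (left_ne_zero_of_mul (h1 ▸ h2))
  have hp0' := Nat.pos_of_ne_zero (right_ne_zero_of_mul (h1 ▸ h2))
  rcases eq_or_ne p.1 1 with h3 | h3
  · simp [h3, hc]
  have : p.2 < m := by nlinarith [show 2 ≤ p.1 by omega]
  congr 1
  exact tsum_congr fun j => by rw [pow_congr a b m h j _ this]

noncomputable def it (c : ℕ → ℂ) : ℕ → ArithmeticFunction ℂ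
  | 0 => 0
  | k + 1 => Phi c (it c k)

lemma it_stab (c : ℕ → ℂ) (hc : c 1 = 0) (k : ℕ) : ∀ m < k, it c k m = it c (k+1) m := by
  induction k with
  | zero => simp
  | succ k ih =>
    intro m hm
    exact Phi_congr c hc _ _ m fun i hi => ih i (by omega)

lemma it_stab' (c : ℕ → ℂ) (hc : c 1 = 0) (m k : ℕ) (h : m + 1 ≤ k) : it c k m = it c (m+1) m := by
  induction k, h using Nat.le_induction with
  | base => rfl
  | succ k hk ih => rw [← it_stab c hc k m (by omega), ih]

noncomputable def lim (c : ℕ → ℂ) : ArithmeticFunction ℂ := ⟨fun m => it c (m+1) m, by simp⟩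

lemma lim_apply (c : ℕ → ℂ) (m : ℕ) : lim c m = it c (m+1) m := rfl

lemma lim_fix (c : ℕ → ℂ) (hc : c 1 = 0) : Phi c (lim c) = lim c := by
  ext m
  rw [lim_apply]
  refine Phi_congr c hc _ _ m fun i hi => ?_
  rw [lim_apply, it_stab' c hc i m (by omega)]

lemma fix_unique (c : ℕ → ℂ) (hc : c 1 = 0) (a b : ArithmeticFunction ℂ) (ha : Phi c a = a)
    (hb : Phi c b = b) : a = b := by
  ext m
  induction m using Nat.strong_induction_on with
  | _ m ih =>
    rw [← ha, ← hb]
    exact Phi_congr c hc _ _ m ih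

lemma it_NN (c : ℕ → ℂ) (hc : c 0 = 0) (s : ℂ) (h : NN (s - (1:ℝ)) c ≤ 1) (k : ℕ) :
    NN s (it c k) ≤ 1 := by
  induction k with
  | zero => simp [NN, it]
  | succ k ih => exact (Phi_NN c hc _ s 1 zero_le_one (by simpa using ih)).trans h

lemma lim_NN (c : ℕ → ℂ) (hc : c 0 = 0) (hc1 : c 1 = 0) (s : ℂ) (h : NN (s - (1:ℝ)) c ≤ 1) :
    NN s (lim c) ≤ 1 := by
  rw [NN, ENNReal.tsum_eq_iSup_nat]
  refine iSup_le fun M => ?_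
  refine le_trans ?_ (it_NN c hc s h M)
  refine le_trans (le_of_eq ?_) (ENNReal.sum_le_tsum (Finset.range M))
  refine Finset.sum_congr rfl fun i hi => ?_
  rw [lim_apply, it_stab' c hc1 i M (by simpa using hi)]

lemma norm_term (x : ℂ) (n : ℕ) (hn : n ≠ 0) (s : ℂ) :
    ‖x * (n : ℂ) ^ (-s)‖ = ‖x‖ * (n : ℝ) ^ (-s.re) := by
  rw [norm_mul, Complex.norm_natCast_cpow_of_pos (Nat.pos_of_ne_zero hn), Complex.neg_re]

lemma NN_anti (c : ℕ → ℂ) (hc : c 0 = 0) (s t : ℂ) (h : s.re ≤ t.re) : NN t c ≤ NN s c := by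
  refine ENNReal.tsum_le_tsum fun n => ?_
  rcases eq_or_ne n 0 with rfl | hn
  · simp [hc]
  rw [← ofReal_norm, ← ofReal_norm, norm_term _ _ hn, norm_term _ _ hn]
  have : (1:ℝ) ≤ n := by exact_mod_cast Nat.pos_of_ne_zero hn
  gcongr

lemma NN_small (c : ℕ → ℂ) (hc : c 0 = 0) (hc1 : c 1 = 0) (s : ℂ) (h : NN s c ≠ ⊤) :
    ∃ θ : ℝ, ∀ t : ℂ, θ < t.re → NN t c ≤ 1 := by
  obtain ⟨N, hN⟩ := pow_unbounded_of_one_lt (NN s c).toReal (one_lt_two (α := ℝ))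
  have key : NN (s + N) c ≤ 1 := by
    have : NN (s + N) c ≤ NN s c * ENNReal.ofReal ((2 ^ N)⁻¹) := by
      rw [NN, NN, ← ENNReal.tsum_mul_right]
      refine ENNReal.tsum_le_tsum fun n => ?_
      rcases eq_or_ne n 0 with rfl | hn
      · simp [hc]
      rcases eq_or_ne n 1 with rfl | hn1
      · simp [hc1]
      have h2 : (2:ℝ) ≤ n := by exact_mod_cast (show 2 ≤ n by omega)
      rw [← ofReal_norm, ← ofReal_norm, norm_term _ _ hn, norm_term _ _ hn,
        ← ENNReal.ofReal_mul (by positivity), mul_assoc]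
      gcongr
      rw [Complex.add_re, neg_add, Real.rpow_add (by positivity)]
      gcongr
      rw [Complex.natCast_re, Real.rpow_neg (by positivity), Real.rpow_natCast]
      gcongr
    refine this.trans ?_
    rw [← ENNReal.ofReal_toReal h, ← ENNReal.ofReal_mul (by positivity)]
    rw [ENNReal.ofReal_le_one, ← div_eq_mul_inv, div_le_one (by positivity)]
    exact hN.le
  exact ⟨(s + N).re, fun t ht => (NN_anti c hc _ _ ht.le).trans key⟩

lemma DS_eq_LSeries (a : ArithmeticFunction ℂ) (s : ℂ) : DSeries a s = LSeries a s := by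
  rw [DSeries, LSeries]
  exact tsum_congr fun n => (LSeries.term_def₀ (by simp) s n).symm

lemma absc_lt (a : ArithmeticFunction ℂ) (s : ℂ) (h : NN s a ≠ ⊤) :
    LSeries.abscissaOfAbsConv a < ⊤ := by
  have : LSeriesSummable a s := by
    refine (Summable.of_enorm h).congr fun n => ?_
    exact (LSeries.term_def₀ (by simp) s n).symm
  exact this.abscissaOfAbsConv_le.trans_lt (EReal.coe_lt_top _)

theorem stmt_12 (c : ℕ → ℂ) (hc : IsD0 c) :
    ∃ b : ℕ → ℂ, IsD0 b ∧
      (∃ θ : ℝ, ∀ s : ℂ, θ < s.re →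
        DSeries c (s + DSeries b s) = DSeries b s) ∧
      ∀ b' : ℕ → ℂ, IsD0 b' →
        (∃ θ : ℝ, ∀ s : ℂ, θ < s.re →
          DSeries c (s + DSeries b' s) = DSeries b' s) →
        b' = b := by
  obtain ⟨h0, h1, θ, hθ⟩ := hc
  have hcs : ∀ s : ℂ, θ < s.re → NN s c ≠ ⊤ := fun s hs => NN_ne_top.mpr (hθ s hs)
  obtain ⟨θ₁, hθ₁⟩ := NN_small c h0 h1 ((θ + 1 : ℝ) : ℂ) (hcs _ (by simp))
  have hlim : ∀ s : ℂ, θ₁ + 1 < s.re → NN s (lim c) ≤ 1 := fun s hs =>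
    lim_NN c h0 h1 s (hθ₁ _ (by simp; linarith))
  refine ⟨lim c, ⟨by simp, ?_, θ₁ + 1, fun s hs => ?_⟩, ⟨θ₁ + 1, fun s hs => ?_⟩, ?_⟩
  · rw [← lim_fix c h1, Phi_apply]
    simp [h1]
  · exact NN_ne_top.mp (ne_top_of_le_ne_top ENNReal.one_ne_top (hlim s hs))
  · rw [← Phi_DS c h0 (lim c) s 1 zero_le_one (by simpa using hlim s hs), lim_fix c h1]
    exact ne_top_of_le_ne_top ENNReal.one_ne_top (hθ₁ _ (by simp; linarith))
  · rintro b' ⟨h0', h1', θ', hθ'⟩ ⟨θ'', hf⟩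
    let a : ArithmeticFunction ℂ := ⟨b', h0'⟩
    have ha : (a : ℕ → ℂ) = b' := rfl
    obtain ⟨θ₂, hθ₂⟩ := NN_small b' h0' h1' ((θ' + 1 : ℝ) : ℂ) (NN_ne_top.mpr (hθ' _ (by simp)))
    obtain ⟨M, hM⟩ : ∃ M : ℝ, M = max θ'' (max θ₂ (θ + 1)) := ⟨_, rfl⟩
    have hfix : ∀ s : ℂ, M < s.re → DSeries (Phi c a) s = DSeries a s ∧
        NN s (Phi c a) ≠ ⊤ := by
      intro s hs
      rw [hM, max_lt_iff, max_lt_iff] at hs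
      have hcK : NN (s - (1 : ℝ)) c ≠ ⊤ := hcs _ (by simp; linarith)
      have hb : NN s a ≤ ENNReal.ofReal 1 := by simpa [ha] using hθ₂ s hs.2.1
      refine ⟨?_, ne_top_of_le_ne_top hcK (Phi_NN c h0 a s 1 zero_le_one hb)⟩
      rw [Phi_DS c h0 a s 1 zero_le_one hb hcK]
      exact hf s hs.1
    have hPa : Phi c a = a := by
      ext n
      rcases eq_or_ne n 0 with rfl | hn
      · simp
      have hA := absc_lt _ ((M + 1 : ℝ) : ℂ) (hfix _ (by rw [Complex.ofReal_re]; linarith)).2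
      have hB := absc_lt a ((θ' + 1 : ℝ) : ℂ)
        (NN_ne_top.mpr (hθ' _ (by rw [Complex.ofReal_re]; linarith)))
      refine LSeries.eq_of_LSeries_eventually_eq hA hB ?_ hn
      filter_upwards [Filter.eventually_gt_atTop M] with x hx
      rw [← DS_eq_LSeries, ← DS_eq_LSeries]
      exact (hfix x (by rwa [Complex.ofReal_re])).1
    have := fix_unique c h1 a (lim c) hPa (lim_fix c h1)
    rw [← ha, this]
end

section
/- Let f(s) = ∑_{n≥2} c_n n^{−s} be a Dirichlet series with complex coefficients and zero constant term that converges absolutely in some half-plane, fix w ∈ ℂ, and let {α_n}_{n≥1} be the family of Dirichlet convolution polynomials generated by f, i.e. α_1 ≡ 1 and for n ≥ 2, α_n(x) = ∑_{k=1}^{Ω(n)} (x^k/k!) · ∑_{n=d_1⋯d_k, each d_i ≥ 2} c_{d_1} c_{d_2} ⋯ c_{d_k}. Then the Dirichlet series g(s) := ∑_{n≥2} α̂_n(w·ln(n)) n^{−s} converges absolutely in some half-plane ℂ_θ and satisfies f(s − w·g(s)) = g(s) for all s ∈ ℂ_θ. -/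
/-- Sum over all ordered `k`-tuples `(d₁,…,d_k)` of integers `dᵢ ≥ 2` with product `n`
of the products `a d₁ ⋯ a d_k`. -/
noncomputable def tupleProdSum (a : ℕ → ℂ) (n k : ℕ) : ℂ :=
  ∑ d ∈ (Fintype.piFinset fun _ : Fin k => Finset.range (n + 1)).filter
      (fun d => (∀ i, 2 ≤ d i) ∧ ∏ i, d i = n), ∏ i, a (d i)

theorem hasSum_pi_pow {𝕜 : Type*} [RCLike 𝕜] (q : ℕ → 𝕜) (hq : Summable fun d => ‖q d‖) (k : ℕ) :
    (Summable fun d : Fin k → ℕ => ‖∏ i, q (d i)‖) ∧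
    HasSum (fun d : Fin k → ℕ => ∏ i, q (d i)) ((∑' d, q d) ^ k) := by
  induction k with
  | zero =>
    constructor
    · exact Summable.of_finite
    · simp
  | succ k ih =>
    have h1 : Summable fun p : ℕ × (Fin k → ℕ) => ‖q p.1 * ∏ i, q (p.2 i)‖ := by
      simpa using hq.mul_norm ih.1
    constructor
    · rw [← (Fin.consEquiv (fun _ : Fin (k+1) => ℕ)).summable_iff]
      convert h1 using 2 with p
      simp [Fin.consEquiv, Fin.prod_univ_succ]
    · rw [← (Fin.consEquiv (fun _ : Fin (k+1) => ℕ)).hasSum_iff]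
      have := (hq.of_norm.hasSum).mul ih.2 h1.of_norm
      rw [pow_succ']
      refine this.congr_fun ?_
      intro p
      simp [Fin.consEquiv, Fin.prod_univ_succ]

theorem circ_exp (L : ℂ) (k : ℕ) :
    ∮ u in C(0, 1), Complex.exp (L * u) * (u ^ (k+1))⁻¹ =
      2 * Real.pi * Complex.I * (L ^ k / (k.factorial : ℂ)) := by
  have h := DifferentiableOn.circleIntegral_one_div_sub_center_pow_smul (c := (0:ℂ)) (R := 1)
    one_pos k (f := fun u => Complex.exp (L * u)) (by fun_prop)
  rw [iteratedDeriv_cexp_const_mul] at h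
  simp only [sub_zero, one_div, smul_eq_mul, mul_zero, Complex.exp_zero, mul_one] at h
  simp_rw [mul_comm (Complex.exp _)]
  rw [h]
  ring

theorem norm_exp_sub_le (L u v : ℂ) (hu : ‖u‖ ≤ 1) (hv : ‖v‖ ≤ 1) :
    ‖Complex.exp (L * u) - Complex.exp (L * v)‖ ≤ Real.exp (2 * ‖L‖) * ‖u - v‖ := by
  refine Convex.norm_image_sub_le_of_norm_hasDerivWithin_le (s := Metric.closedBall (0:ℂ) 1)
    (f := fun u => Complex.exp (L * u)) (f' := fun u => Complex.exp (L * u) * L)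
    (fun x hx => ?_) (fun x hx => ?_) (convex_closedBall _ _) (by simpa using hv) (by simpa using hu)
  · have := ((hasDerivAt_id x).const_mul L).cexp
    simpa using this.hasDerivWithinAt
  · have hx : ‖x‖ ≤ 1 := by simpa using hx
    rw [norm_mul, two_mul, Real.exp_add]
    gcongr
    · refine (Complex.norm_exp_le_exp_norm _).trans (Real.exp_le_exp.2 ?_)
      rw [norm_mul]; exact mul_le_of_le_one_right (norm_nonneg _) hx
    · linarith [Real.add_one_le_exp ‖L‖]

theorem summable_idx (a : ℕ → ℝ) (ha0 : ∀ d, 0 ≤ a d) (ha : Summable a) (hS : ∑' d, a d ≤ 1 / 2) :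
    Summable fun x : (Σ k : ℕ, (Fin (k + 1) → ℕ)) => ∏ i, a (x.2 i) := by
  have h := hasSum_pi_pow a ha.norm
  rw [summable_sigma_of_nonneg (fun x => Finset.prod_nonneg fun i _ => ha0 _)]
  constructor
  · exact fun k => (h (k+1)).2.summable
  · simp only [fun k => (h (k+1)).2.tsum_eq]
    have : Summable fun k => (∑' d, a d) ^ k :=
      summable_geometric_of_lt_one (tsum_nonneg ha0) (by linarith)
    exact (summable_nat_add_iff 1).2 this

theorem norm_term_le (q l u : ℂ) (hu : ‖u‖ ≤ 2) :
    ‖q * Complex.exp (l * u)‖ ≤ ‖q‖ * Real.exp (2 * ‖l‖) := by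
  rw [norm_mul]
  gcongr
  refine (Complex.norm_exp_le_exp_norm _).trans (Real.exp_le_exp.2 ?_)
  rw [norm_mul]; nlinarith [norm_nonneg l]

theorem norm_phi_le (q l : ℕ → ℂ) (ha : Summable fun d => ‖q d‖ * Real.exp (2 * ‖l d‖))
    (hS : ∑' d, ‖q d‖ * Real.exp (2 * ‖l d‖) ≤ 1 / 2) (u : ℂ) (hu : ‖u‖ ≤ 2) :
    ‖∑' d, q d * Complex.exp (l d * u)‖ ≤ 1 / 2 :=
  (tsum_of_norm_bounded ha.hasSum fun d => norm_term_le _ _ _ hu).trans hS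

theorem key_integral (q l : ℕ → ℂ) (ha : Summable fun d => ‖q d‖ * Real.exp (2 * ‖l d‖))
    (hS : ∑' d, ‖q d‖ * Real.exp (2 * ‖l d‖) ≤ 1 / 2) :
    HasSum (fun x : (Σ k : ℕ, (Fin (k + 1) → ℕ)) =>
      2 * Real.pi * Complex.I *
        ((∏ i, q (x.2 i)) * (∑ i, l (x.2 i)) ^ x.1 / ((x.1 + 1).factorial : ℂ)))
      (∮ u in C(0, 1), -Complex.log (1 - (∑' d, q d * Complex.exp (l d * u)) / u)) := by
  have hsum := summable_idx _ (fun d => by positivity) ha hS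
  have key : ∀ x : (Σ k : ℕ, (Fin (k + 1) → ℕ)), 2 * Real.pi * Complex.I *
        ((∏ i, q (x.2 i)) * (∑ i, l (x.2 i)) ^ x.1 / ((x.1 + 1).factorial : ℂ)) =
        ∮ u in C(0, 1), ((∏ i, q (x.2 i)) / ((x.1 : ℂ) + 1)) *
          (Complex.exp ((∑ i, l (x.2 i)) * u) * (u ^ (x.1 + 1))⁻¹) := by
    intro x
    rw [circleIntegral.integral_const_mul, circ_exp, Nat.factorial_succ]
    push_cast
    have : (x.1 : ℂ) + 1 ≠ 0 := Nat.cast_add_one_ne_zero _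
    have : (x.1.factorial : ℂ) ≠ 0 := by exact_mod_cast x.1.factorial_ne_zero
    field_simp
  simp_rw [key]
  have bd : ∀ (x : (Σ k : ℕ, (Fin (k + 1) → ℕ))) (u : ℂ), ‖u‖ = 1 →
      ‖((∏ i, q (x.2 i)) / ((x.1 : ℂ) + 1)) *
          (Complex.exp ((∑ i, l (x.2 i)) * u) * (u ^ (x.1 + 1))⁻¹)‖ ≤
        ∏ i, (‖q (x.2 i)‖ * Real.exp (2 * ‖l (x.2 i)‖)) := by
    intro x u hu
    have e : ((∏ i, q (x.2 i)) / ((x.1 : ℂ) + 1)) *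
          (Complex.exp ((∑ i, l (x.2 i)) * u) * (u ^ (x.1 + 1))⁻¹) =
        (∏ i, q (x.2 i) * Complex.exp (l (x.2 i) * u)) * (((x.1 : ℂ) + 1)⁻¹ * (u ^ (x.1 + 1))⁻¹) := by
      rw [Finset.sum_mul, Complex.exp_sum, Finset.prod_mul_distrib]; ring
    rw [e, norm_mul, norm_prod]
    have h1 : ‖((x.1 : ℂ) + 1)⁻¹ * (u ^ (x.1 + 1))⁻¹‖ ≤ 1 := by
      rw [norm_mul, norm_inv, norm_inv, norm_pow, hu]
      simp only [one_pow, inv_one, mul_one]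
      apply inv_le_one_of_one_le₀
      have : ((x.1 : ℂ) + 1) = ((x.1 + 1 : ℕ) : ℂ) := by push_cast; rfl
      rw [this, Complex.norm_natCast]
      push_cast
      linarith [Nat.cast_nonneg (α := ℝ) x.1]
    refine (mul_le_of_le_one_right (Finset.prod_nonneg fun i _ => norm_nonneg _) h1).trans ?_
    exact Finset.prod_le_prod (fun i _ => norm_nonneg _)
      fun i _ => norm_term_le _ _ _ (by rw [hu]; norm_num)
  unfold circleIntegral
  refine intervalIntegral.hasSum_integral_of_dominated_convergence
    (fun x _ => ∏ i, (‖q (x.2 i)‖ * Real.exp (2 * ‖l (x.2 i)‖))) ?_ ?_ ?_ ?_ ?_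
  · intro x
    apply Continuous.aestronglyMeasurable
    have h0 : ∀ θ : ℝ, circleMap 0 1 θ ^ (x.1 + 1) ≠ 0 := fun θ =>
      pow_ne_zero _ (circleMap_ne_center one_ne_zero)
    have hc : Continuous (circleMap 0 1) := continuous_circleMap 0 1
    simp only [deriv_circleMap]
    fun_prop (disch := exact h0)
  · refine fun x => Filter.Eventually.of_forall fun θ _ => ?_
    rw [norm_smul]
    have : ‖deriv (circleMap 0 1) θ‖ = 1 := by simp [deriv_circleMap]
    rw [this, one_mul]
    exact bd x _ (by simp)
  · exact Filter.Eventually.of_forall fun θ _ => hsum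
  · exact intervalIntegrable_const
  · refine Filter.Eventually.of_forall fun θ _ => ?_
    apply HasSum.const_smul
    set u := circleMap 0 1 θ
    have hu : ‖u‖ = 1 := by simp [u]
    have hq : Summable fun d => ‖q d * Complex.exp (l d * u)‖ :=
      Summable.of_nonneg_of_le (fun _ => norm_nonneg _)
        (fun d => norm_term_le _ _ _ (by rw [hu]; norm_num)) ha
    have hz : ‖(∑' d, q d * Complex.exp (l d * u)) / u‖ < 1 := by
      rw [norm_div, hu, div_one]
      exact (norm_phi_le q l ha hS u (by rw [hu]; norm_num)).trans_lt (by norm_num)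
    have ht := Complex.hasSum_taylorSeries_neg_log hz
    have ht' := (hasSum_nat_add_iff' 1).2 ht
    simp only [Finset.range_one, Finset.sum_singleton, Nat.cast_zero, div_zero, sub_zero] at ht'
    refine HasSum.sigma_of_hasSum ht' (fun k => ?_) (Summable.of_norm_bounded hsum fun x => bd x u hu)
    have h2 := ((hasSum_pi_pow _ hq (k+1)).2).mul_right (((k : ℂ) + 1)⁻¹ * (u ^ (k + 1))⁻¹)
    have e2 : ((∑' d, q d * Complex.exp (l d * u)) / u) ^ (k + 1) / ((k + 1 : ℕ) : ℂ) =
        (∑' d, q d * Complex.exp (l d * u)) ^ (k + 1) * (((k : ℂ) + 1)⁻¹ * (u ^ (k + 1))⁻¹) := by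
      push_cast
      rw [div_pow]; ring
    rw [e2]
    refine h2.congr_fun fun d => ?_
    · beta_reduce
      simp only
      rw [Finset.sum_mul, Complex.exp_sum, Finset.prod_mul_distrib]; ring

theorem phi_lip (q l : ℕ → ℂ) (ha : Summable fun d => ‖q d‖ * Real.exp (2 * ‖l d‖))
    (hS : ∑' d, ‖q d‖ * Real.exp (2 * ‖l d‖) ≤ 1 / 2) (u v : ℂ) (hu : ‖u‖ ≤ 1) (hv : ‖v‖ ≤ 1) :
    ‖(∑' d, q d * Complex.exp (l d * u)) - ∑' d, q d * Complex.exp (l d * v)‖ ≤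
      1 / 2 * ‖u - v‖ := by
  have hs : ∀ u : ℂ, ‖u‖ ≤ 1 → Summable fun d => q d * Complex.exp (l d * u) := fun u hu =>
    Summable.of_norm_bounded ha fun d => norm_term_le _ _ _ (by linarith)
  rw [← (hs u hu).tsum_sub (hs v hv)]
  refine (tsum_of_norm_bounded (ha.hasSum.mul_right ‖u - v‖) fun d => ?_).trans
    (mul_le_mul_of_nonneg_right hS (norm_nonneg _))
  rw [← mul_sub, norm_mul, mul_assoc]
  exact mul_le_mul_of_nonneg_left (norm_exp_sub_le _ _ _ hu hv) (norm_nonneg _)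

theorem exists_fix (φ : ℂ → ℂ) (h1 : ∀ u, ‖u‖ ≤ 1 → ‖φ u‖ ≤ 1 / 2)
    (h2 : ∀ u v, ‖u‖ ≤ 1 → ‖v‖ ≤ 1 → ‖φ u - φ v‖ ≤ 1 / 2 * ‖u - v‖) :
    ∃ y, ‖y‖ ≤ 1 / 2 ∧ φ y = y := by
  have hm : Set.MapsTo φ (Metric.closedBall 0 1) (Metric.closedBall 0 1) := fun u hu => by
    have := h1 u (by simpa using hu)
    simp only [Metric.mem_closedBall, dist_zero_right]
    linarith
  have hc : ContractingWith (1/2) (hm.restrict φ _ _) := by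
    refine ⟨by norm_num, LipschitzWith.of_dist_le_mul fun u v => ?_⟩
    have := h2 u v (mem_closedBall_zero_iff.1 u.2) (mem_closedBall_zero_iff.1 v.2)
    simp only [Subtype.dist_eq, Set.MapsTo.val_restrict_apply, dist_eq_norm]
    simpa using this
  obtain ⟨y, hy, hf, -⟩ := hc.exists_fixedPoint' (Metric.isClosed_closedBall.isComplete) hm (x := 0)
    (by simp) (edist_ne_top _ _)
  refine ⟨y, ?_, hf⟩
  have := h1 y (by simpa using hy)
  rwa [hf] at this

theorem log_mul_re (x y : ℂ) (hx : 0 < x.re) (hy : 0 < y.re) :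
    Complex.log (x * y) = Complex.log x + Complex.log y := by
  have hx0 : x ≠ 0 := by rintro rfl; simp at hx
  have hy0 : y ≠ 0 := by rintro rfl; simp at hy
  have h1 := abs_lt.1 (Complex.abs_arg_lt_pi_div_two_iff.2 (Or.inl hx))
  have h2 := abs_lt.1 (Complex.abs_arg_lt_pi_div_two_iff.2 (Or.inl hy))
  exact (Complex.log_mul_eq_add_log_iff hx0 hy0).2 ⟨by linarith, by linarith⟩

theorem re_pos_of_norm (z : ℂ) (hz : ‖z‖ ≤ 1 / 2) : 0 < (1 - z).re := by
  have := Complex.re_le_norm z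
  simp only [Complex.sub_re, Complex.one_re]
  linarith

theorem integral_eq (φ : ℂ → ℂ) (h1 : ∀ u, ‖u‖ ≤ 1 → ‖φ u‖ ≤ 1 / 2)
    (h2 : ∀ u v, ‖u‖ ≤ 1 → ‖v‖ ≤ 1 → ‖φ u - φ v‖ ≤ 1 / 2 * ‖u - v‖)
    (hd : DifferentiableOn ℂ φ (Metric.ball 0 2)) (y : ℂ) (hy : ‖y‖ ≤ 1 / 2) (hf : φ y = y) :
    (∮ u in C(0, 1), -Complex.log (1 - φ u / u)) = ∮ u in C(0, 1), -Complex.log (1 - y / u) := by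
  have hy2 : Metric.ball (0:ℂ) 2 ∈ nhds y := Metric.isOpen_ball.mem_nhds (by
    simp only [Metric.mem_ball, dist_zero_right]; linarith)
  have hy1 : Metric.closedBall (0:ℂ) 1 ∈ nhds y := Filter.mem_of_superset
    (Metric.isOpen_ball.mem_nhds (x := y) (s := Metric.ball 0 1) (by
    simp only [Metric.mem_ball, dist_zero_right]; linarith)) Metric.ball_subset_closedBall
  have hds := (Complex.differentiableOn_dslope hy2).2 hd
  have hdn : ∀ u, ‖u‖ ≤ 1 → ‖dslope φ y u‖ ≤ 1 / 2 := by
    intro u hu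
    by_cases huy : u = y
    · subst huy
      rw [dslope_same]
      refine norm_deriv_le_of_lip' (by norm_num) ?_
      filter_upwards [hy1] with v hv
      exact h2 v u (by simpa using hv) hu
    · rw [dslope_of_ne _ huy, slope_def_field, norm_div]
      refine div_le_of_le_mul₀ (norm_nonneg _) (by norm_num) (h2 u y hu (by linarith))
  have hH : DifferentiableOn ℂ (fun u => Complex.log (1 - dslope φ y u)) (Metric.closedBall 0 1) := by
    refine DifferentiableOn.clog ((differentiableOn_const 1).sub
      (hds.mono (Metric.closedBall_subset_ball (by norm_num)))) fun u hu => ?_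
    exact Or.inl (re_pos_of_norm _ (hdn u (by simpa using hu)))
  have hH0 : (∮ u in C(0, 1), Complex.log (1 - dslope φ y u)) = 0 := by
    refine DiffContOnCl.circleIntegral_eq_zero zero_le_one (DifferentiableOn.diffContOnCl ?_)
    exact hH.mono (by rw [closure_ball _ one_ne_zero])
  have hc : CircleIntegrable (fun u => -Complex.log (1 - y / u)) 0 1 := by
    refine ContinuousOn.circleIntegrable zero_le_one ?_
    refine ContinuousOn.neg (ContinuousOn.clog ?_ fun u hu => ?_)
    · refine continuousOn_const.sub (continuousOn_const.div continuousOn_id fun u hu => ?_)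
      rintro h
      simp [h] at hu
    · have hu : ‖u‖ = 1 := by simpa using hu
      exact Or.inl (re_pos_of_norm _ (by rw [norm_div, hu, div_one]; exact hy))
  have hc2 : CircleIntegrable (fun u => Complex.log (1 - dslope φ y u)) 0 1 :=
    ContinuousOn.circleIntegrable zero_le_one (hH.continuousOn.mono Metric.sphere_subset_closedBall)
  have hs := circleIntegral.integral_sub hc hc2
  rw [hH0, sub_zero] at hs
  rw [← hs]
  refine circleIntegral.integral_congr zero_le_one fun u hu => ?_
  have hu : ‖u‖ = 1 := by simpa using hu
  have hu0 : u ≠ 0 := by rintro rfl; simp at hu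
  have huy : u ≠ y := by rintro rfl; linarith
  have e : 1 - φ u / u = (1 - y / u) * (1 - dslope φ y u) := by
    rw [dslope_of_ne _ huy, slope_def_field, hf]
    have : u - y ≠ 0 := sub_ne_zero.2 huy
    field_simp
    ring
  rw [e, log_mul_re]
  · ring
  · exact re_pos_of_norm _ (by rw [norm_div, hu, div_one]; exact hy)
  · exact re_pos_of_norm _ (hdn u hu.le)

theorem integral_const_eq (y : ℂ) (hy : ‖y‖ ≤ 1 / 2) :
    (∮ u in C(0, 1), -Complex.log (1 - y / u)) = 2 * Real.pi * Complex.I * y := by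
  have h := key_integral (fun d => if d = 0 then y else 0) (fun _ => 0)
    (by
      refine summable_of_ne_finset_zero (s := {0}) fun d hd => ?_
      have : d ≠ 0 := by simpa using hd
      simp [this])
    (by
      rw [tsum_eq_single 0 (fun d hd => by simp [hd])]
      simpa using hy)
  have e : (∑' d : ℕ, if d = 0 then y else 0) = y := by simp
  simp only [zero_mul, Complex.exp_zero, mul_one, e] at h
  refine h.unique ?_
  have h3 := hasSum_single (f := fun x : (Σ k : ℕ, (Fin (k + 1) → ℕ)) =>
      2 * Real.pi * Complex.I *
        ((∏ i, if x.2 i = 0 then y else 0) * (∑ i : Fin (x.1 + 1), (0:ℂ)) ^ x.1 /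
          ((x.1 + 1).factorial : ℂ))) ⟨0, fun _ => 0⟩ (by
    rintro ⟨k, d⟩ hx
    rcases k with _ | k
    · have : d 0 ≠ 0 := by
        intro h0
        apply hx
        congr 1
        funext i
        rw [show i = 0 from Subsingleton.elim (α := Fin 1) i 0, h0]
      simp [this]
    · simp)
  simpa using h3

theorem main_abs (q l : ℕ → ℂ) (ha : Summable fun d => ‖q d‖ * Real.exp (2 * ‖l d‖))
    (hS : ∑' d, ‖q d‖ * Real.exp (2 * ‖l d‖) ≤ 1 / 2) :
    ∃ y : ℂ, (∑' d, q d * Complex.exp (l d * y)) = y ∧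
      HasSum (fun x : (Σ k : ℕ, (Fin (k + 1) → ℕ)) =>
        ((∏ i, q (x.2 i)) * (∑ i, l (x.2 i)) ^ x.1 / ((x.1 + 1).factorial : ℂ))) y := by
  have h1 : ∀ u : ℂ, ‖u‖ ≤ 1 → ‖∑' d, q d * Complex.exp (l d * u)‖ ≤ 1 / 2 := fun u hu =>
    norm_phi_le q l ha hS u (by linarith)
  have h2 := phi_lip q l ha hS
  obtain ⟨y, hy, hf⟩ := exists_fix (fun u => ∑' d, q d * Complex.exp (l d * u)) h1 h2
  refine ⟨y, hf, ?_⟩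
  have hk := key_integral q l ha hS
  have hd : DifferentiableOn ℂ (fun u => ∑' d, q d * Complex.exp (l d * u)) (Metric.ball 0 2) := by
    refine Complex.differentiableOn_tsum_of_summable_norm ha (fun d => by fun_prop)
      Metric.isOpen_ball fun d u hu => norm_term_le _ _ _ ?_
    have : ‖u‖ < 2 := by simpa using hu
    exact this.le
  rw [integral_eq (fun u => ∑' d, q d * Complex.exp (l d * u)) h1 h2 hd y hy hf,
    integral_const_eq y hy] at hk
  exact (hasSum_mul_left_iff Complex.two_pi_I_ne_zero).1 hk

theorem card_le_cardFactors (k : ℕ) (d : Fin k → ℕ) (h : ∀ i, 2 ≤ d i) :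
    k ≤ ArithmeticFunction.cardFactors (∏ i, d i) := by
  induction k with
  | zero => simp
  | succ k ih =>
    rw [Fin.prod_univ_succ, ArithmeticFunction.cardFactors_mul]
    · have h1 := ih (fun i => d i.succ) fun i => h _
      have h2 : 0 < ArithmeticFunction.cardFactors (d 0) :=
        ArithmeticFunction.cardFactors_pos_iff_one_lt.2 (h 0)
      omega
    · have := h 0; omega
    · exact Finset.prod_ne_zero_iff.2 fun i _ => by have := h i.succ; omega

theorem prod_natCast_cpow (k : ℕ) (d : Fin k → ℕ) (z : ℂ) :
    ∏ i, (d i : ℂ) ^ z = ((∏ i, d i : ℕ) : ℂ) ^ z := by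
  induction k with
  | zero => simp
  | succ k ih =>
    rw [Fin.prod_univ_succ, Fin.prod_univ_succ, ih]
    push_cast
    rw [← Nat.cast_prod, Complex.natCast_mul_natCast_cpow]

theorem fiber_sum (c : ℕ → ℂ) (hc0 : c 0 = 0) (hc1 : c 1 = 0) (w s : ℂ) (n : ℕ) :
    (∑' x : ((fun x : (Σ k : ℕ, (Fin (k + 1) → ℕ)) => ∏ i, x.2 i) ⁻¹' {n}),
      ((∏ i, (c (x.1.2 i) * (x.1.2 i : ℂ) ^ (-s))) * (∑ i, w * (Real.log (x.1.2 i) : ℂ)) ^ x.1.1 /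
        ((x.1.1 + 1).factorial : ℂ))) =
    (if 2 ≤ n then ∑ k ∈ Finset.range (ArithmeticFunction.cardFactors n),
      (w * (Real.log n : ℂ)) ^ k / ((k + 1).factorial : ℂ) * tupleProdSum c n (k + 1) else 0) *
      (n : ℂ) ^ (-s) := by
  have hc : ∀ m, m < 2 → c m = 0 := by
    intro m hm
    interval_cases m <;> assumption
  rw [tsum_subtype ((fun x : (Σ k : ℕ, (Fin (k + 1) → ℕ)) => ∏ i, x.2 i) ⁻¹' {n})
    (fun x => (∏ i, (c (x.2 i) * (x.2 i : ℂ) ^ (-s))) * (∑ i, w * (Real.log (x.2 i) : ℂ)) ^ x.1 /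
        ((x.1 + 1).factorial : ℂ))]
  have hz : ∀ x : (Σ k : ℕ, (Fin (k + 1) → ℕ)), (∃ i, x.2 i < 2) →
      (∏ i, (c (x.2 i) * (x.2 i : ℂ) ^ (-s))) = 0 := by
    rintro x ⟨i, hi⟩
    exact Finset.prod_eq_zero (Finset.mem_univ i) (by rw [hc _ hi, zero_mul])
  by_cases hn : 2 ≤ n
  · rw [if_pos hn, tsum_eq_sum (s := (Finset.range (ArithmeticFunction.cardFactors n)).sigma fun k =>
      (Fintype.piFinset fun _ : Fin (k + 1) => Finset.range (n + 1)).filter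
      (fun d => (∀ i, 2 ≤ d i) ∧ ∏ i, d i = n)), Finset.sum_sigma, Finset.sum_mul]
    · refine Finset.sum_congr rfl fun k _ => ?_
      rw [tupleProdSum, Finset.mul_sum, Finset.sum_mul]
      refine Finset.sum_congr rfl fun d hd => ?_
      obtain ⟨-, h2, hp⟩ := Finset.mem_filter.1 hd
      rw [Set.indicator_of_mem (by simpa using hp)]
      simp only
      rw [Finset.prod_mul_distrib, prod_natCast_cpow, hp, ← Finset.mul_sum]
      have hl : (∑ i, (Real.log (d i) : ℂ)) = (Real.log n : ℂ) := by
        rw [← hp]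
        rw [← Complex.ofReal_sum, Nat.cast_prod, Real.log_prod]
        intro i _
        have := h2 i
        positivity
      rw [hl]
      ring
    · rintro ⟨k, d⟩ hx
      by_cases hp : ∏ i, d i = n
      · rw [Set.indicator_of_mem (by simpa using hp)]
        by_cases h2 : ∃ i, d i < 2
        · rw [hz _ h2]; simp
        · push Not at h2
          exfalso
          apply hx
          simp only [Finset.mem_sigma, Finset.mem_range, Finset.mem_filter, Fintype.mem_piFinset]
          refine ⟨?_, fun i => ?_, h2, hp⟩
          · have := card_le_cardFactors (k+1) d h2
            rw [hp] at this
            omega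
          · have : d i ∣ n := hp ▸ Finset.dvd_prod_of_mem d (Finset.mem_univ i)
            exact Nat.lt_succ_of_le (Nat.le_of_dvd (by omega) this)
      · rw [Set.indicator_of_notMem (by simpa using hp)]
  · rw [if_neg hn, zero_mul]
    convert tsum_zero with x
    by_cases hp : ∏ i, x.2 i = n
    · rw [Set.indicator_of_mem (by simpa using hp)]
      rw [hz]
      · simp
      · by_contra h
        push Not at h
        have h1 := card_le_cardFactors (x.1+1) x.2 h
        rw [hp] at h1
        have : n = 0 ∨ n = 1 := by omega
        rcases this with rfl | rfl <;> simp at h1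
    · rw [Set.indicator_of_notMem (by simpa using hp)]

theorem hat_eval (T : ℕ → ℂ) (N : ℕ) (α αh : Polynomial ℂ)
    (hα : ∀ x : ℂ, α.eval x = ∑ k ∈ Finset.Icc 1 N, x ^ k / (Nat.factorial k : ℂ) * T k)
    (hh : Polynomial.X * αh = α) (x : ℂ) :
    αh.eval x = ∑ k ∈ Finset.range N, x ^ k / ((k + 1).factorial : ℂ) * T (k + 1) := by
  have : αh = ∑ k ∈ Finset.range N,
      Polynomial.C (T (k + 1) / ((k + 1).factorial : ℂ)) * Polynomial.X ^ k := by
    apply mul_left_cancel₀ (Polynomial.X_ne_zero (R := ℂ))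
    rw [hh]
    refine Polynomial.funext fun z => ?_
    rw [hα, Polynomial.eval_mul, Polynomial.eval_X, Polynomial.eval_finsetSum, Finset.mul_sum,
      ← Finset.Ico_add_one_right_eq_Icc, Finset.sum_Ico_eq_sum_range]
    refine Finset.sum_congr (by simp) fun k _ => ?_
    simp only [Polynomial.eval_mul, Polynomial.eval_C, Polynomial.eval_pow, Polynomial.eval_X]
    rw [add_comm 1 k]
    ring
  rw [this, Polynomial.eval_finsetSum]
  refine Finset.sum_congr rfl fun k _ => ?_
  simp only [Polynomial.eval_mul, Polynomial.eval_C, Polynomial.eval_pow, Polynomial.eval_X]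
  ring

theorem exists_theta (c : ℕ → ℂ) (hc0 : c 0 = 0) (hc1 : c 1 = 0)
    (hconv : ∃ θ : ℝ, ∀ s : ℂ, θ < s.re → Summable fun n : ℕ => ‖c n * (n : ℂ) ^ (-s)‖)
    (w : ℂ) : ∃ θ : ℝ, ∀ s : ℂ, θ < s.re →
      (Summable fun d : ℕ => ‖c d * (d : ℂ) ^ (-s)‖ * Real.exp (2 * ‖w * (Real.log d : ℂ)‖)) ∧
      ∑' d : ℕ, ‖c d * (d : ℂ) ^ (-s)‖ * Real.exp (2 * ‖w * (Real.log d : ℂ)‖) ≤ 1 / 2 := by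
  obtain ⟨θ, hθ⟩ := hconv
  have hs0 := hθ ((θ + 1 : ℝ) : ℂ) (by simp)
  set M := ∑' n : ℕ, ‖c n * (n : ℂ) ^ (-((θ + 1 : ℝ) : ℂ))‖ with hM
  have hM0 : 0 ≤ M := tsum_nonneg fun _ => norm_nonneg _
  have hlogM : 0 ≤ Real.log (2 * (M + 1)) := Real.log_nonneg (by linarith)
  refine ⟨θ + 1 + 2 * ‖w‖ + 2 * Real.log (2 * (M + 1)), fun s hs => ?_⟩
  have key : ∀ d : ℕ, ‖c d * (d : ℂ) ^ (-s)‖ * Real.exp (2 * ‖w * (Real.log d : ℂ)‖) ≤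
      ‖c d * (d : ℂ) ^ (-((θ + 1 : ℝ) : ℂ))‖ * (2 * (M + 1))⁻¹ := by
    intro d
    rcases Nat.lt_or_ge d 2 with hd | hd
    · have : c d = 0 := by interval_cases d <;> assumption
      simp [this]
    · have hd0 : 0 < d := by omega
      have hdr : (2:ℝ) ≤ d := by exact_mod_cast hd
      have hdr0 : (0:ℝ) < d := by linarith
      have hl : 1 / 2 ≤ Real.log d := by
        have := Real.log_two_gt_d9
        have := Real.log_le_log two_pos hdr
        linarith
      rw [norm_mul, norm_mul (c d), norm_mul w, Complex.norm_natCast_cpow_of_pos hd0,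
        Complex.norm_natCast_cpow_of_pos hd0, Complex.norm_real, Real.norm_eq_abs,
        abs_of_nonneg (by linarith : 0 ≤ Real.log d), mul_assoc, mul_assoc]
      refine mul_le_mul_of_nonneg_left ?_ (norm_nonneg _)
      rw [Real.rpow_def_of_pos hdr0, Real.rpow_def_of_pos hdr0, ← Real.exp_add,
        ← Real.exp_log (by linarith : 0 < 2 * (M + 1)), ← Real.exp_neg, ← Real.exp_add]
      apply Real.exp_le_exp.2
      simp only [Complex.neg_re, Complex.ofReal_re]
      have hA := mul_nonneg (by linarith : 0 ≤ Real.log d) (sub_nonneg.2 hs.le)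
      have hB := mul_le_mul_of_nonneg_right hl hlogM
      nlinarith
  have hsum := hs0.mul_right (2 * (M + 1))⁻¹
  have h1 := Summable.of_nonneg_of_le (fun d => by positivity) key hsum
  refine ⟨h1, (h1.tsum_le_tsum key hsum).trans ?_⟩
  rw [tsum_mul_right, ← hM, ← div_eq_mul_inv, div_le_div_iff₀ (by linarith) (by norm_num)]
  linarith

theorem stmt_15 (c : ℕ → ℂ) (hc0 : c 0 = 0) (hc1 : c 1 = 0)
    (hconv : ∃ θ : ℝ, ∀ s : ℂ, θ < s.re → Summable fun n : ℕ => ‖c n * (n : ℂ) ^ (-s)‖)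
    (w : ℂ)
    (α : ℕ → Polynomial ℂ) (hα1 : α 1 = 1)
    -- `α` is the family of Dirichlet convolution polynomials generated by `f`:
    (hαn : ∀ n : ℕ, 2 ≤ n → ∀ x : ℂ,
      (α n).eval x = ∑ k ∈ Finset.Icc 1 (ArithmeticFunction.cardFactors n),
        x ^ k / (Nat.factorial k : ℂ) * tupleProdSum c n k)
    (αhat : ℕ → Polynomial ℂ)
    (hhat : ∀ n : ℕ, 2 ≤ n → Polynomial.X * αhat n = α n)
    -- coefficients of `g(s) = ∑_{n ≥ 2} α̂_n(w·ln n) n^{-s}`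
    (b : ℕ → ℂ)
    (hb : ∀ n : ℕ, b n = if 2 ≤ n then (αhat n).eval (w * (Real.log n : ℂ)) else 0) :
    ∃ θ : ℝ,
      (∀ s : ℂ, θ < s.re → Summable fun n : ℕ => ‖b n * (n : ℂ) ^ (-s)‖) ∧
      (∀ s : ℂ, θ < s.re → DSeries c (s - w * DSeries b s) = DSeries b s) := by
  obtain ⟨θ, hθ⟩ := exists_theta c hc0 hc1 hconv w
  have main : ∀ s : ℂ, θ < s.re → ∃ y : ℂ, HasSum (fun n : ℕ => b n * (n : ℂ) ^ (-s)) y ∧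
      DSeries c (s - w * y) = y := by
    intro s hs
    obtain ⟨ha, hS⟩ := hθ s hs
    obtain ⟨y, hy, hsum⟩ := main_abs (fun d => c d * (d : ℂ) ^ (-s))
      (fun d => w * (Real.log d : ℂ)) ha hS
    refine ⟨y, ?_, ?_⟩
    · have h := hsum.tsum_fiberwise (fun x => ∏ i, x.2 i)
      refine h.congr_fun fun n => ?_
      have hf := fiber_sum c hc0 hc1 w s n
      refine Eq.trans ?_ hf.symm
      rw [hb]
      congr 1
      split_ifs with hn
      · exact hat_eval (tupleProdSum c n) _ (α n) (αhat n) (hαn n hn) (hhat n hn) _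
      · rfl
    · rw [DSeries]
      refine Eq.trans (tsum_congr fun d => ?_) hy
      rcases Nat.eq_zero_or_pos d with rfl | hd
      · simp [hc0]
      · have hd0 : (d : ℂ) ≠ 0 := by exact_mod_cast hd.ne'
        rw [mul_assoc, show -(s - w * y) = -s + w * y by ring, Complex.cpow_add _ _ hd0,
          Complex.cpow_def_of_ne_zero hd0 (w * y), Complex.natCast_log]
        ring_nf
  refine ⟨θ, fun s hs => ?_, fun s hs => ?_⟩
  · obtain ⟨y, h, -⟩ := main s hs
    exact h.summable.norm
  · obtain ⟨y, h, h2⟩ := main s hs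
    have : DSeries b s = y := h.tsum_eq
    rw [this, h2]
end

section
/- Let f(s) = ∑_{n≥2} c_n n^{−s} be a Dirichlet series with complex coefficients and zero constant term that converges absolutely in some half-plane, fix w ∈ ℂ, let {α_n}_{n≥1} be the family of Dirichlet convolution polynomials generated by f (α_1 ≡ 1 and for n ≥ 2, α_n(x) = ∑_{k=1}^{Ω(n)} (x^k/k!) · ∑_{n=d_1⋯d_k, each d_i ≥ 2} c_{d_1}⋯c_{d_k}), and let g(s) := ∑_{n≥2} α̂_n(w·ln(n)) n^{−s}. Then for every x ∈ ℂ the Dirichlet series ∑_{n≥2} α̂_n(x + w·ln(n)) n^{−s} converges absolutely in some half-plane ℂ_θ and one has exp( x·g(s) ) = 1 + x · ∑_{n≥2} α̂_n(x + w·ln(n)) n^{−s} for all s ∈ ℂ_θ. -/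
noncomputable def gSeq {R : Type*} [CommRing R] [Algebra ℂ R] (D : Derivation ℂ R R) (f : R) : ℕ → R
  | 0 => f
  | m + 1 => ((1 : ℂ) / (m + 1)) • ∑ i : Fin (m + 1), gSeq D f i * D (gSeq D f (m - i))

noncomputable def liftD {R : Type*} [CommRing R] [Algebra ℂ R] (D : Derivation ℂ R R) :
    Derivation ℂ (PowerSeries R) (PowerSeries R) :=
  Derivation.mk'
    { toFun := fun P => PowerSeries.mk fun n => D (PowerSeries.coeff n P)
      map_add' := by intro P Q; ext n; simp
      map_smul' := by intro a P; ext n; simp }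
    (by
      intro P Q
      ext n
      simp only [LinearMap.coe_mk, AddHom.coe_mk, PowerSeries.coeff_mk, PowerSeries.coeff_mul,
        map_sum, Derivation.leibniz, smul_eq_mul, map_add, Finset.sum_add_distrib]
      congr 1
      rw [← Finset.Nat.sum_antidiagonal_swap]; rfl)

theorem coeff_liftD {R : Type*} [CommRing R] [Algebra ℂ R] (D : Derivation ℂ R R)
    (P : PowerSeries R) (n : ℕ) :
    PowerSeries.coeff n (liftD D P) = D (PowerSeries.coeff n P) := by
  simp [liftD]

theorem gSeq_ode {R : Type*} [CommRing R] [Algebra ℂ R] (D : Derivation ℂ R R) (f : R) :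
    PowerSeries.derivative R (PowerSeries.mk (gSeq D f)) =
      PowerSeries.mk (gSeq D f) * liftD D (PowerSeries.mk (gSeq D f)) := by
  ext m
  rw [PowerSeries.coeff_derivative, PowerSeries.coeff_mul, PowerSeries.coeff_mk, gSeq]
  simp only [coeff_liftD, PowerSeries.coeff_mk]
  rw [Finset.Nat.sum_antidiagonal_eq_sum_range_succ (fun i j => gSeq D f i * D (gSeq D f j)),
    Finset.sum_range]
  have : ((m : R) + 1) = algebraMap ℂ R (m + 1) := by simp
  rw [this, mul_comm, ← Algebra.smul_def, smul_smul, mul_one_div_cancel, one_smul]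
  exact Nat.cast_add_one_ne_zero m

theorem lagrange_formal {R : Type*} [CommRing R] [Algebra ℂ R] (D : Derivation ℂ R R) (f : R)
    (m : ℕ) : ∀ k : ℕ, PowerSeries.coeff m ((PowerSeries.mk (gSeq D f)) ^ (k + 1)) =
      (((k + 1 : ℕ) : ℂ) / ((k + 1 + m : ℕ) * (m.factorial : ℂ))) • (D^[m] (f ^ (k + 1 + m))) := by
  set G := PowerSeries.mk (gSeq D f) with hG
  have key : ∀ k : ℕ, ((k + 2 : ℕ) : ℂ) • PowerSeries.derivative R (G ^ (k + 1)) =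
      ((k + 1 : ℕ) : ℂ) • liftD D (G ^ (k + 2)) := by
    intro k
    rw [PowerSeries.derivative_pow, Derivation.leibniz_pow, gSeq_ode, ← hG]
    simp only [Nat.add_sub_cancel, smul_eq_mul, nsmul_eq_mul, show k + 2 - 1 = k + 1 from rfl]
    simp only [Algebra.smul_def, map_natCast]
    ring
  induction m with
  | zero =>
    intro k
    have : ((k : ℂ) + 1) ≠ 0 := Nat.cast_add_one_ne_zero k
    simp [hG, gSeq, this]
  | succ m ih =>
    intro k
    have h := congrArg (PowerSeries.coeff m) (key k)
    rw [PowerSeries.coeff_smul, PowerSeries.coeff_smul, PowerSeries.coeff_derivative, coeff_liftD, ih (k+1)] at h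
    have e : ((m : R) + 1) = algebraMap ℂ R (m + 1) := by simp
    rw [e, mul_comm, ← Algebra.smul_def, Derivation.map_smul, ← Function.iterate_succ_apply' D, smul_smul, smul_smul] at h
    have h2 : ((k + 2 : ℕ) : ℂ) * (m + 1) ≠ 0 := by
      refine mul_ne_zero (Nat.cast_ne_zero.2 (by omega)) (Nat.cast_add_one_ne_zero m)
    have h3 : ((k + 1 + 1 + m : ℕ) : ℂ) ≠ 0 := by
      exact_mod_cast (by omega)
    have h4 : ((m.factorial : ℕ) : ℂ) ≠ 0 := by exact_mod_cast m.factorial_ne_zero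
    have h5 := congrArg (fun z => (((k + 2 : ℕ) : ℂ) * (m + 1))⁻¹ • z) h
    simp only [smul_smul, inv_mul_cancel₀ h2, one_smul] at h5
    rw [h5, show k + 1 + (m + 1) = k + 1 + 1 + m by ring]
    congr 1
    rw [Nat.factorial_succ]
    have h6 : ((k + 2 : ℕ) : ℂ) ≠ 0 := left_ne_zero_of_mul h2
    have h7 : ((m : ℂ) + 1) ≠ 0 := right_ne_zero_of_mul h2
    rw [Nat.cast_mul, Nat.cast_succ m]
    field_simp

noncomputable def logMulAF (h : ArithmeticFunction ℂ) : ArithmeticFunction ℂ :=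
  ⟨fun n => (Real.log n : ℂ) * h n, by simp⟩

theorem logMulAF_apply (h : ArithmeticFunction ℂ) (n : ℕ) :
    logMulAF h n = (Real.log n : ℂ) * h n := rfl

noncomputable def logD : Derivation ℂ (ArithmeticFunction ℂ) (ArithmeticFunction ℂ) :=
  Derivation.mk'
    { toFun := logMulAF
      map_add' := by
        intro P Q; ext n
        simp only [logMulAF_apply, ArithmeticFunction.add_apply, mul_add]
      map_smul' := by
        intro a P; ext n
        simp only [logMulAF_apply, ArithmeticFunction.smul_map, smul_eq_mul, RingHom.id_apply]
        ring }
    (by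
      intro P Q
      ext n
      simp only [LinearMap.coe_mk, AddHom.coe_mk, logMulAF_apply, smul_eq_mul, mul_comm Q,
        ArithmeticFunction.add_apply, ArithmeticFunction.mul_apply, Finset.mul_sum,
        ← Finset.sum_add_distrib]
      refine Finset.sum_congr rfl fun p hp => ?_
      have ⟨h1, h2⟩ := Nat.ne_zero_of_mem_divisorsAntidiagonal hp
      have h3 := (Nat.mem_divisorsAntidiagonal.mp hp).1
      rw [← h3, Nat.cast_mul, Real.log_mul (by exact_mod_cast h1) (by exact_mod_cast h2)]
      push_cast
      ring)

theorem logD_iter (h : ArithmeticFunction ℂ) (m n : ℕ) :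
    (logD^[m] h) n = (Real.log n : ℂ) ^ m * h n := by
  induction m with
  | zero => simp
  | succ m ih =>
    rw [Function.iterate_succ_apply']
    change (Real.log n : ℂ) * (logD^[m] h) n = _
    rw [ih]; ring

theorem pow_apply_eq_zero (f : ArithmeticFunction ℂ) (hf : f 1 = 0) (k : ℕ) :
    ∀ n, ArithmeticFunction.cardFactors n < k → (f ^ k) n = 0 := by
  induction k with
  | zero => intro n h; omega
  | succ k ih =>
    intro n h
    rw [pow_succ', ArithmeticFunction.mul_apply]
    refine Finset.sum_eq_zero fun p hp => ?_
    have ⟨h1, h2⟩ := Nat.ne_zero_of_mem_divisorsAntidiagonal hp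
    have h3 := (Nat.mem_divisorsAntidiagonal.mp hp).1
    by_cases hp1 : p.1 = 1
    · rw [hp1, hf, zero_mul]
    · rw [ih, mul_zero]
      rw [← h3, ArithmeticFunction.cardFactors_mul h1 h2] at h
      have : 0 < ArithmeticFunction.cardFactors p.1 :=
        ArithmeticFunction.cardFactors_pos_iff_one_lt.2 (by omega)
      omega

theorem pow_apply_finMul (f : ArithmeticFunction ℂ) (k : ℕ) :
    ∀ n, (f ^ k) n = ∑ d ∈ Nat.finMulAntidiag k n, ∏ i, f (d i) := by
  induction k with
  | zero =>
    intro n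
    by_cases hn : n = 1
    · subst hn; simp [Nat.finMulAntidiag_one]
    · simp [Nat.finMulAntidiag_zero_left hn, hn]
  | succ k ih =>
    intro n
    rw [pow_succ', ArithmeticFunction.mul_apply]
    simp_rw [ih, Finset.mul_sum]
    rw [Finset.sum_sigma']
    refine Finset.sum_bij' (fun q _ => (Fin.cons q.1.1 q.2 : Fin (k+1) → ℕ))
      (fun d _ => ⟨(d 0, ∏ i : Fin k, d i.succ), Fin.tail d⟩) ?_ ?_ ?_ ?_ ?_
    · rintro ⟨⟨a, b⟩, e⟩ h
      simp only [Finset.mem_sigma, Nat.mem_divisorsAntidiagonal, Nat.mem_finMulAntidiag] at h ⊢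
      simp [Fin.prod_univ_succ, h.2.1, h.1]
    · intro d h
      simp only [Finset.mem_sigma, Nat.mem_divisorsAntidiagonal, Nat.mem_finMulAntidiag] at h ⊢
      rw [Fin.prod_univ_succ] at h
      refine ⟨h, rfl, ?_⟩
      intro h0
      exact h.2 (by rw [← h.1, h0, mul_zero])
    · rintro ⟨⟨a, b⟩, e⟩ h
      simp only [Finset.mem_sigma, Nat.mem_divisorsAntidiagonal, Nat.mem_finMulAntidiag] at h ⊢
      simp [h.2.1]
    · intro d h
      simp
    · rintro ⟨⟨a, b⟩, e⟩ h
      simp [Fin.prod_univ_succ]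

theorem tuple_eq (f : ArithmeticFunction ℂ) (h1 : f 1 = 0) (n k : ℕ) (hn : n ≠ 0) :
    tupleProdSum f n k = (f ^ k) n := by
  rw [pow_apply_finMul, tupleProdSum]
  refine Finset.sum_subset_zero_on_sdiff ?_ ?_ (fun _ _ => rfl)
  · intro d hd
    simp only [Finset.mem_filter] at hd
    exact Nat.mem_finMulAntidiag.2 ⟨hd.2.2, hn⟩
  · intro d hd
    rw [Finset.mem_sdiff] at hd
    obtain ⟨hd, hd'⟩ := hd
    have hp := Nat.mem_finMulAntidiag.1 hd
    by_contra hne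
    apply hd'
    have hne' := Finset.prod_ne_zero_iff.1 hne
    simp only [Finset.mem_filter, Fintype.mem_piFinset, Finset.mem_range]
    refine ⟨fun i => ?_, fun i => ?_, hp.1⟩
    · exact Nat.lt_succ_of_le (Nat.le_of_dvd (Nat.pos_of_ne_zero hn)
        (Nat.dvd_of_mem_finMulAntidiag hd i))
    · have := hne' i (Finset.mem_univ i)
      by_contra hlt
      have : d i = 0 ∨ d i = 1 := by omega
      rcases this with h | h <;> simp_all

theorem hat_eval_s16 (f : ArithmeticFunction ℂ) (h1 : f 1 = 0) (n : ℕ) (hn : 2 ≤ n)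
    (p q : Polynomial ℂ) (hq : Polynomial.X * q = p)
    (hp : ∀ x : ℂ, p.eval x = ∑ k ∈ Finset.Icc 1 (ArithmeticFunction.cardFactors n),
        x ^ k / (Nat.factorial k : ℂ) * tupleProdSum f n k) (x : ℂ) :
    q.eval x = ∑ k ∈ Finset.range (ArithmeticFunction.cardFactors n),
        x ^ k / (Nat.factorial (k + 1) : ℂ) * (f ^ (k + 1)) n := by
  set N := ArithmeticFunction.cardFactors n
  let q' : Polynomial ℂ := ∑ k ∈ Finset.range N,
    Polynomial.C (1 / (Nat.factorial (k + 1) : ℂ) * (f ^ (k + 1)) n) * Polynomial.X ^ k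
  have hq' : ∀ x, q'.eval x = ∑ k ∈ Finset.range N,
        x ^ k / (Nat.factorial (k + 1) : ℂ) * (f ^ (k + 1)) n := by
    intro x
    simp only [q', Polynomial.eval_finsetSum, Polynomial.eval_mul, Polynomial.eval_C,
      Polynomial.eval_pow, Polynomial.eval_X]
    exact Finset.sum_congr rfl fun k _ => by ring
  rw [← hq']
  congr 1
  apply mul_left_cancel₀ (Polynomial.X_ne_zero (R := ℂ))
  rw [hq]
  refine Polynomial.funext fun y => ?_
  rw [hp, Polynomial.eval_mul, hq', Polynomial.eval_X, Finset.mul_sum, Finset.range_eq_Ico,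
    ← Finset.Ico_add_one_right_eq_Icc, Finset.sum_Ico_eq_sum_range, Finset.range_eq_Ico]
  refine Finset.sum_congr (by simp) fun k _ => ?_
  rw [tuple_eq f h1 n _ (by omega), add_comm 1 k, pow_succ]
  ring

open LSeries in
theorem norm_term_mul (F H : ArithmeticFunction ℂ) (σ : ℝ)
    (hF : Summable fun n => ‖term F σ n‖) (hH : Summable fun n => ‖term H σ n‖) :
    (Summable fun n => ‖term (F * H : ArithmeticFunction ℂ) σ n‖) ∧
    ∑' n, ‖term (F * H : ArithmeticFunction ℂ) σ n‖ ≤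
      (∑' n, ‖term F σ n‖) * (∑' n, ‖term H σ n‖) := by
  have ht : ∀ (K : ArithmeticFunction ℂ) (n : ℕ),
      term (fun n => (‖K n‖ : ℂ)) σ n = ((‖term K σ n‖ : ℝ) : ℂ) := by
    intro K n
    rcases eq_or_ne n 0 with rfl | hn
    · simp
    · rw [term_of_ne_zero hn, term_of_ne_zero hn, norm_div,
        Complex.norm_natCast_cpow_of_pos (Nat.pos_of_ne_zero hn), Complex.ofReal_div,
        Complex.ofReal_cpow (Nat.cast_nonneg n)]
      simp
  have hF' : LSeriesHasSum (fun n => (‖F n‖ : ℂ)) σ ((∑' n, ‖term F σ n‖ : ℝ) : ℂ) := by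
    rw [LSeriesHasSum, funext (ht F)]
    exact_mod_cast hF.hasSum
  have hH' : LSeriesHasSum (fun n => (‖H n‖ : ℂ)) σ ((∑' n, ‖term H σ n‖ : ℝ) : ℂ) := by
    rw [LSeriesHasSum, funext (ht H)]
    exact_mod_cast hH.hasSum
  have hc := hF'.convolution hH'
  rw [LSeriesHasSum] at hc
  have e : term (LSeries.convolution (fun n => (‖F n‖ : ℂ)) (fun n => (‖H n‖ : ℂ))) σ =
      fun n => ((∑ p ∈ n.divisorsAntidiagonal, ‖term F σ p.1‖ * ‖term H σ p.2‖ : ℝ) : ℂ) := by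
    funext n
    rw [term_convolution]
    push_cast
    exact Finset.sum_congr rfl fun p _ => by rw [ht, ht]
  rw [e, ← Complex.ofReal_mul, Complex.hasSum_ofReal] at hc
  have hle : ∀ n, ‖term (F * H : ArithmeticFunction ℂ) σ n‖ ≤
      ∑ p ∈ n.divisorsAntidiagonal, ‖term F σ p.1‖ * ‖term H σ p.2‖ := by
    intro n
    rw [← ArithmeticFunction.coe_mul, term_convolution]
    refine (norm_sum_le _ _).trans (le_of_eq ?_)
    simp
  have hs := Summable.of_nonneg_of_le (fun n => norm_nonneg _) hle hc.summable
  exact ⟨hs, (hs.tsum_le_tsum hle hc.summable).trans hc.tsum_eq.le⟩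

open LSeries in
theorem norm_term_pow (f : ArithmeticFunction ℂ) (σ : ℝ)
    (hf : Summable fun n => ‖term f σ n‖) (j : ℕ) :
    (Summable fun n => ‖term (f ^ (j + 1) : ArithmeticFunction ℂ) σ n‖) ∧
    ∑' n, ‖term (f ^ (j + 1) : ArithmeticFunction ℂ) σ n‖ ≤ (∑' n, ‖term f σ n‖) ^ (j + 1) := by
  induction j with
  | zero => simpa using hf
  | succ j ih =>
    have h := norm_term_mul (f ^ (j + 1)) f σ ih.1 hf
    rw [pow_succ f (j + 1)]
    refine ⟨h.1, h.2.trans ?_⟩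
    rw [pow_succ _ (j + 1)]
    exact mul_le_mul_of_nonneg_right ih.2 (tsum_nonneg fun n => norm_nonneg _)

theorem term_eq (h : ArithmeticFunction ℂ) (s : ℂ) (n : ℕ) :
    LSeries.term h s n = h n * (n : ℂ) ^ (-s) := by
  rcases eq_or_ne n 0 with rfl | hn
  · simp
  · rw [LSeries.term_of_ne_zero hn, Complex.cpow_neg, div_eq_mul_inv]

open LSeries in
theorem exists_sigma (f : ArithmeticFunction ℂ) (h1 : f 1 = 0)
    (hconv : ∃ θ : ℝ, ∀ s : ℂ, θ < s.re → Summable fun n : ℕ => ‖f n * (n : ℂ) ^ (-s)‖) :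
    ∃ σ : ℝ, (Summable fun n => ‖term f σ n‖) ∧ ∑' n, ‖term f σ n‖ ≤ 1 / 2 := by
  obtain ⟨θ, hθ⟩ := hconv
  have h := hθ ((θ + 1 : ℝ) : ℂ) (by simp)
  simp only [← term_eq] at h
  set Q := ∑' n, ‖term f ((θ + 1 : ℝ) : ℂ) n‖ with hQ
  obtain ⟨t, ht⟩ := pow_unbounded_of_one_lt (2 * Q) (one_lt_two)
  have hle : ∀ n, ‖term f ((θ + 1 + t : ℝ) : ℂ) n‖ ≤ (2 ^ t)⁻¹ * ‖term f ((θ + 1 : ℝ) : ℂ) n‖ := by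
    intro n
    rcases eq_or_ne n 0 with rfl | hn
    · simp
    rcases eq_or_ne n 1 with rfl | hn1
    · simp [term_of_ne_zero, h1]
    have hpos : 0 < n := Nat.pos_of_ne_zero hn
    have hn2 : (2 : ℝ) ≤ n := by exact_mod_cast (by omega : 2 ≤ n)
    rw [term_of_ne_zero hn, term_of_ne_zero hn, norm_div, norm_div,
      Complex.norm_natCast_cpow_of_pos hpos, Complex.norm_natCast_cpow_of_pos hpos,
      Complex.ofReal_re, Complex.ofReal_re, Real.rpow_add (by positivity), Real.rpow_natCast,
      inv_mul_eq_div, div_div]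
    have : (2 : ℝ) ^ t ≤ (n : ℝ) ^ t := by gcongr
    gcongr
  have hs := Summable.of_nonneg_of_le (fun n => norm_nonneg _) hle (h.mul_left _)
  refine ⟨θ + 1 + t, hs, ?_⟩
  refine (hs.tsum_le_tsum hle (h.mul_left _)).trans ?_
  rw [tsum_mul_left, ← hQ, inv_mul_le_iff₀ (by positivity)]
  linarith

/-- coefficients of powers of the formal solution -/
noncomputable def PP (f : ArithmeticFunction ℂ) (k m : ℕ) : ArithmeticFunction ℂ :=
  PowerSeries.coeff m ((PowerSeries.mk (gSeq logD f)) ^ (k + 1))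

theorem PP_apply (f : ArithmeticFunction ℂ) (k m n : ℕ) :
    PP f k m n = (((k + 1 : ℕ) : ℂ) / ((k + 1 + m : ℕ) * (m.factorial : ℂ))) *
      ((Real.log n : ℂ) ^ m * (f ^ (k + m + 1)) n) := by
  rw [PP, lagrange_formal, ArithmeticFunction.smul_map, logD_iter, smul_eq_mul,
    show k + 1 + m = k + m + 1 by ring]

theorem PP_succ (f : ArithmeticFunction ℂ) (k m : ℕ) :
    PP f (k + 1) m = ∑ p ∈ Finset.HasAntidiagonal.antidiagonal m, PP f k p.1 * PP f 0 p.2 := by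
  rw [PP, pow_succ, PowerSeries.coeff_mul]
  simp [PP]

open LSeries in
theorem term_bound (f : ArithmeticFunction ℂ) (w s : ℂ) (σ : ℝ) (hs : σ + ‖w‖ < s.re)
    (k m n : ℕ) : ‖w ^ m * term (PP f k m) s n‖ ≤
      ‖term (f ^ (k + m + 1) : ArithmeticFunction ℂ) σ n‖ := by
  rcases eq_or_ne n 0 with rfl | hn
  · simp
  have hpos : 0 < n := Nat.pos_of_ne_zero hn
  have hn1 : (1 : ℝ) ≤ n := by exact_mod_cast hpos
  have hL : 0 ≤ Real.log n := Real.log_nonneg hn1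
  rw [term_of_ne_zero hn, term_of_ne_zero hn, PP_apply, norm_mul, norm_div, norm_div,
      Complex.norm_natCast_cpow_of_pos hpos, Complex.norm_natCast_cpow_of_pos hpos,
      Complex.ofReal_re, norm_mul, norm_mul, norm_div, norm_mul, norm_pow, norm_pow,
      Complex.norm_natCast, Complex.norm_natCast, Complex.norm_natCast, Complex.norm_real,
      Real.norm_of_nonneg hL]
  set A := ‖(f ^ (k + m + 1)) n‖
  have hA : 0 ≤ A := norm_nonneg _
  have h1 : (‖w‖ * Real.log n) ^ m / m.factorial ≤ (n : ℝ) ^ ‖w‖ := by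
    refine (Real.pow_div_factorial_le_exp _ (by positivity) m).trans ?_
    rw [Real.rpow_def_of_pos (by positivity), mul_comm]
  have h2 : (((k + 1 : ℕ) : ℝ) / (k + 1 + m : ℕ)) ≤ 1 := by
    rw [div_le_one (by positivity)]
    exact_mod_cast (by omega)
  have h3 : (n : ℝ) ^ σ * (n : ℝ) ^ ‖w‖ ≤ (n : ℝ) ^ s.re := by
    rw [← Real.rpow_add (by positivity)]
    exact Real.rpow_le_rpow_of_exponent_le hn1 hs.le
  have hx : 0 < (n : ℝ) ^ σ := by positivity
  have hy : 0 < (n : ℝ) ^ s.re := by positivity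
  have hz : 0 < (n : ℝ) ^ ‖w‖ := by positivity
  calc _ = (((k + 1 : ℕ) : ℝ) / (k + 1 + m : ℕ)) * ((‖w‖ * Real.log n) ^ m / m.factorial)
          * (A / (n : ℝ) ^ s.re) := by rw [mul_pow]; field_simp
    _ ≤ 1 * (n : ℝ) ^ ‖w‖ * (A / (n : ℝ) ^ s.re) := by gcongr
    _ ≤ 1 * (n : ℝ) ^ ‖w‖ * (A / ((n : ℝ) ^ σ * (n : ℝ) ^ ‖w‖)) := by gcongr
    _ = A / (n : ℝ) ^ σ := by field_simp

open LSeries in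
theorem summable_N (f : ArithmeticFunction ℂ) (σ : ℝ)
    (hf : Summable fun n => ‖term f σ n‖) (hq : ∑' n, ‖term f σ n‖ ≤ 1 / 2) :
    Summable fun p : (ℕ × ℕ) × ℕ => ‖term (f ^ (p.1.1 + p.1.2 + 1) : ArithmeticFunction ℂ) σ p.2‖ := by
  rw [summable_prod_of_nonneg (fun p => norm_nonneg _)]
  refine ⟨fun p => (norm_term_pow f σ hf (p.1 + p.2)).1, ?_⟩
  have hg : Summable fun p : ℕ × ℕ => ((1 / 2 : ℝ) ^ p.1) * ((1 / 2 : ℝ) ^ p.2) :=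
    summable_geometric_two.mul_of_nonneg summable_geometric_two
      (fun _ => by positivity) (fun _ => by positivity)
  refine Summable.of_nonneg_of_le (fun p => tsum_nonneg fun n => norm_nonneg _) (fun p => ?_) hg
  refine (norm_term_pow f σ hf (p.1 + p.2)).2.trans ?_
  have h0 : 0 ≤ ∑' n, ‖term f σ n‖ := tsum_nonneg fun n => norm_nonneg _
  calc _ ≤ (1 / 2 : ℝ) ^ (p.1 + p.2 + 1) := by gcongr
    _ ≤ (1 / 2 : ℝ) ^ (p.1 + p.2) := by
      rw [pow_succ]
      have : 0 ≤ (1 / 2 : ℝ) ^ (p.1 + p.2) := by positivity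
      linarith
    _ = _ := pow_add _ _ _

theorem LSeries_AF_sum {ι : Type} (S : Finset ι) (F : ι → ArithmeticFunction ℂ) (s : ℂ)
    (hF : ∀ i ∈ S, LSeriesSummable (F i) s) :
    LSeries (∑ i ∈ S, F i : ArithmeticFunction ℂ) s = ∑ i ∈ S, LSeries (F i) s := by
  rw [← LSeries_sum hF]
  congr 1
  classical
  clear hF
  induction S using Finset.induction_on with
  | empty => ext n; simp
  | insert a S ha ih =>
    rw [Finset.sum_insert ha, Finset.sum_insert ha, ← ih]
    ext n
    rfl

theorem LSeries_PP_succ (f : ArithmeticFunction ℂ) (s : ℂ)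
    (hL : ∀ k m, LSeriesSummable (PP f k m) s) (k m : ℕ) :
    LSeries (PP f (k + 1) m) s = ∑ p ∈ Finset.HasAntidiagonal.antidiagonal m,
      LSeries (PP f k p.1) s * LSeries (PP f 0 p.2) s := by
  have h := LSeries_AF_sum (Finset.HasAntidiagonal.antidiagonal m)
    (fun p : ℕ × ℕ => PP f k p.1 * PP f 0 p.2) s
    (fun p _ => ArithmeticFunction.LSeriesSummable_mul (hL k p.1) (hL 0 p.2))
  rw [PP_succ, h]
  refine Finset.sum_congr rfl fun p _ => ?_
  exact ArithmeticFunction.LSeries_mul' (hL k p.1) (hL 0 p.2)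

open LSeries in
theorem V_pow (f : ArithmeticFunction ℂ) (w s : ℂ)
    (hS : Summable fun p : (ℕ × ℕ) × ℕ => ‖w ^ p.1.2 * term (PP f p.1.1 p.1.2) s p.2‖)
    (hL : ∀ k m, LSeriesSummable (PP f k m) s) (k : ℕ) :
    ∑' m, ∑' n, w ^ m * term (PP f k m) s n = (∑' m, ∑' n, w ^ m * term (PP f 0 m) s n) ^ (k + 1) := by
  have hS0 : ∀ k m, Summable fun n => ‖w ^ m * term (PP f k m) s n‖ := fun k m =>
    hS.prod_factor (k, m)
  have hsm : ∀ k, Summable fun m => ‖∑' n, w ^ m * term (PP f k m) s n‖ := by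
    intro k
    have h1 : Summable fun p : ℕ × ℕ => ∑' n, ‖w ^ p.2 * term (PP f p.1 p.2) s n‖ := hS.prod
    refine Summable.of_nonneg_of_le (fun m => norm_nonneg _) (fun m => ?_) (h1.prod_factor k)
    exact norm_tsum_le_tsum_norm (hS0 k m)
  induction k with
  | zero => simp
  | succ k ih =>
    rw [pow_succ, ← ih, tsum_mul_tsum_eq_tsum_sum_antidiagonal_of_summable_norm (hsm k) (hsm 0)]
    refine tsum_congr fun m => ?_
    simp only [tsum_mul_left]
    change w ^ m * LSeries _ s = ∑ p ∈ Finset.HasAntidiagonal.antidiagonal m, w ^ p.1 * LSeries _ s * (w ^ p.2 * LSeries _ s)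
    have : LSeries (PP f (k + 1) m) s = 
        ∑ p ∈ Finset.HasAntidiagonal.antidiagonal m, LSeries (PP f k p.1) s * LSeries (PP f 0 p.2) s := by
      exact LSeries_PP_succ f s hL k m
    rw [this, Finset.mul_sum]
    refine Finset.sum_congr rfl fun p hp => ?_
    rw [← Finset.HasAntidiagonal.mem_antidiagonal.1 hp, pow_add]
    ring

theorem inner_binom_sum (f : ArithmeticFunction ℂ) (w x : ℂ) (j n : ℕ) :
    ∑ p ∈ Finset.HasAntidiagonal.antidiagonal j,
      x ^ p.1 / ((p.1 + 1).factorial : ℂ) * (w ^ p.2 * PP f p.1 p.2 n) =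
    (x + w * (Real.log n : ℂ)) ^ j / ((j + 1).factorial : ℂ) * (f ^ (j + 1)) n := by
  rw [Commute.add_pow' (Commute.all _ _), Finset.sum_div, Finset.sum_mul]
  refine Finset.sum_congr rfl fun p hp => ?_
  obtain ⟨k, m⟩ := p
  have hj : k + m = j := Finset.HasAntidiagonal.mem_antidiagonal.1 hp
  subst hj
  simp only
  rw [PP_apply, show k + 1 + m = k + m + 1 by ring, nsmul_eq_mul, mul_pow,
    Nat.cast_add_choose ℂ, Nat.factorial_succ, Nat.factorial_succ]
  have a1 : ((k.factorial : ℕ) : ℂ) ≠ 0 := Nat.cast_ne_zero.2 k.factorial_ne_zero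
  have a2 : ((m.factorial : ℕ) : ℂ) ≠ 0 := Nat.cast_ne_zero.2 m.factorial_ne_zero
  have a3 : (((k + m).factorial : ℕ) : ℂ) ≠ 0 := Nat.cast_ne_zero.2 (k + m).factorial_ne_zero
  have a4 : ((k + 1 : ℕ) : ℂ) ≠ 0 := Nat.cast_ne_zero.2 (by omega)
  have a5 : ((k + m + 1 : ℕ) : ℂ) ≠ 0 := Nat.cast_ne_zero.2 (by omega)
  rw [Nat.cast_mul, Nat.cast_mul]
  field_simp

open LSeries in
theorem main_sum (f : ArithmeticFunction ℂ) (h1 : f 1 = 0) (w s : ℂ)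
    (hS : Summable fun p : (ℕ × ℕ) × ℕ => ‖w ^ p.1.2 * term (PP f p.1.1 p.1.2) s p.2‖)
    (x : ℂ) (bx : ℕ → ℂ)
    (hbx : ∀ n, bx n = ∑ j ∈ Finset.range (ArithmeticFunction.cardFactors n),
      (x + w * (Real.log n : ℂ)) ^ j / ((j + 1).factorial : ℂ) * (f ^ (j + 1)) n) :
    (Summable fun n : ℕ => ‖bx n * (n : ℂ) ^ (-s)‖) ∧
    DSeries bx s = ∑' k : ℕ, x ^ k / ((k + 1).factorial : ℂ) *
      ∑' m, ∑' n, w ^ m * term (PP f k m) s n := by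
  let T : (ℕ × ℕ) × ℕ → ℂ := fun p =>
    x ^ p.1.1 / ((p.1.1 + 1).factorial : ℂ) * (w ^ p.1.2 * term (PP f p.1.1 p.1.2) s p.2)
  have hT : Summable fun p => ‖T p‖ := by
    refine Summable.of_nonneg_of_le (fun _ => norm_nonneg _) (fun p => ?_)
      (hS.mul_left (Real.exp ‖x‖))
    rw [norm_mul]
    refine mul_le_mul_of_nonneg_right ?_ (norm_nonneg _)
    rw [norm_div, norm_pow, Complex.norm_natCast]
    refine le_trans ?_ (Real.pow_div_factorial_le_exp _ (norm_nonneg x) p.1.1)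
    have : ((p.1.1.factorial : ℕ) : ℝ) ≤ ((p.1.1 + 1).factorial : ℕ) := by
      exact_mod_cast Nat.factorial_le (by omega)
    gcongr
  have hT' : Summable fun q : ℕ × (ℕ × ℕ) => ‖T q.swap‖ :=
    (Equiv.prodComm ℕ (ℕ × ℕ)).summable_iff.2 hT
  have hfib : ∀ n, ∑' p : ℕ × ℕ, T (p, n) = bx n * (n : ℂ) ^ (-s) := by
    intro n
    have hn : Summable fun p : ℕ × ℕ => T (p, n) := (hT'.prod_factor n).of_norm
    have hn2 : Summable fun c : (Σ j : ℕ, (Finset.HasAntidiagonal.antidiagonal j : Finset (ℕ × ℕ))) =>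
        T (Finset.HasAntidiagonal.sigmaAntidiagonalEquivProd c, n) :=
      Finset.HasAntidiagonal.sigmaAntidiagonalEquivProd.summable_iff.2 hn
    rw [← Finset.HasAntidiagonal.sigmaAntidiagonalEquivProd.tsum_eq, hn2.tsum_sigma]
    have : ∀ j, ∑' c : (Finset.HasAntidiagonal.antidiagonal j : Finset (ℕ × ℕ)),
        T (Finset.HasAntidiagonal.sigmaAntidiagonalEquivProd ⟨j, c⟩, n) =
        ((x + w * (Real.log n : ℂ)) ^ j / ((j + 1).factorial : ℂ) * (f ^ (j + 1)) n)
          * (n : ℂ) ^ (-s) := by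
      intro j
      rw [← inner_binom_sum, Finset.sum_mul]
      refine (Finset.tsum_subtype _ (fun p : ℕ × ℕ => T (p, n))).trans ?_
      refine Finset.sum_congr rfl fun p _ => ?_
      simp only [T, term_eq]
      ring
    rw [tsum_congr this, hbx, Finset.sum_mul]
    refine tsum_eq_sum fun j hj => ?_
    rw [pow_apply_eq_zero f h1, mul_zero, zero_mul]
    rw [Finset.mem_range] at hj
    omega
  constructor
  · refine Summable.of_nonneg_of_le (fun _ => norm_nonneg _) (fun n => ?_) hT'.prod
    rw [← hfib]
    exact norm_tsum_le_tsum_norm (hT'.prod_factor n)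
  · rw [DSeries, ← tsum_congr hfib]
    have e1 : ∑' n, ∑' p, T (p, n) = ∑' q, T q := by
      rw [← (Equiv.prodComm ℕ (ℕ × ℕ)).tsum_eq T]
      exact (hT'.of_norm.tsum_prod).symm
    rw [e1, hT.of_norm.tsum_prod, hT.of_norm.prod.tsum_prod]
    refine tsum_congr fun k => ?_
    rw [← tsum_mul_left]
    refine tsum_congr fun m => ?_
    rw [← tsum_mul_left]

theorem stmt_16 (c : ℕ → ℂ) (hc0 : c 0 = 0) (hc1 : c 1 = 0)
    (hconv : ∃ θ : ℝ, ∀ s : ℂ, θ < s.re → Summable fun n : ℕ => ‖c n * (n : ℂ) ^ (-s)‖)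
    (w : ℂ)
    (α : ℕ → Polynomial ℂ) (hα1 : α 1 = 1)
    -- `α` is the family of Dirichlet convolution polynomials generated by `f`:
    (hαn : ∀ n : ℕ, 2 ≤ n → ∀ x : ℂ,
      (α n).eval x = ∑ k ∈ Finset.Icc 1 (ArithmeticFunction.cardFactors n),
        x ^ k / (Nat.factorial k : ℂ) * tupleProdSum c n k)
    (αhat : ℕ → Polynomial ℂ)
    (hhat : ∀ n : ℕ, 2 ≤ n → Polynomial.X * αhat n = α n)
    -- coefficients of `g(s) = ∑_{n ≥ 2} α̂_n(w·ln n) n^{-s}`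
    (b : ℕ → ℂ)
    (hb : ∀ n : ℕ, b n = if 2 ≤ n then (αhat n).eval (w * (Real.log n : ℂ)) else 0)
    (x : ℂ)
    -- coefficients of the series `∑_{n ≥ 2} α̂_n(x + w·ln n) n^{-s}`
    (bx : ℕ → ℂ)
    (hbx : ∀ n : ℕ, bx n = if 2 ≤ n then (αhat n).eval (x + w * (Real.log n : ℂ)) else 0) :
    ∃ θ : ℝ,
      (∀ s : ℂ, θ < s.re → Summable fun n : ℕ => ‖bx n * (n : ℂ) ^ (-s)‖) ∧
      (∀ s : ℂ, θ < s.re →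
        Complex.exp (x * DSeries b s) = 1 + x * DSeries bx s) := by
  obtain ⟨f, hf⟩ : ∃ f : ArithmeticFunction ℂ, ∀ n, f n = c n := ⟨⟨c, hc0⟩, fun _ => rfl⟩
  have hfc : (f : ℕ → ℂ) = c := funext hf
  have h1 : f 1 = 0 := by rw [hf, hc1]
  subst hfc
  obtain ⟨σ, hσ, hq⟩ := exists_sigma f h1 hconv
  have hb' : ∀ (y : ℂ) (a : ℕ → ℂ),
      (∀ n : ℕ, a n = if 2 ≤ n then (αhat n).eval (y + w * (Real.log n : ℂ)) else 0) →
      ∀ n, a n = ∑ j ∈ Finset.range (ArithmeticFunction.cardFactors n),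
        (y + w * (Real.log n : ℂ)) ^ j / ((j + 1).factorial : ℂ) * (f ^ (j + 1)) n := by
    intro y a ha n
    rw [ha]
    split_ifs with hn
    · exact hat_eval_s16 f h1 n hn _ _ (hhat n hn) (hαn n hn) _
    · have : ArithmeticFunction.cardFactors n = 0 := by
        rw [ArithmeticFunction.cardFactors_eq_zero_iff_eq_zero_or_one]
        omega
      simp [this]
  have hN := summable_N f σ hσ hq
  have hS : ∀ s : ℂ, σ + (‖w‖ + 1) < s.re → Summable fun p : (ℕ × ℕ) × ℕ =>
      ‖w ^ p.1.2 * LSeries.term (PP f p.1.1 p.1.2) s p.2‖ := fun s hs =>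
    Summable.of_nonneg_of_le (fun _ => norm_nonneg _)
      (fun p => term_bound f w s σ (by linarith) _ _ _) hN
  have hL : ∀ s : ℂ, σ + (‖w‖ + 1) < s.re → ∀ k m, LSeriesSummable (PP f k m) s := by
    intro s hs k m
    have hw : ‖((‖w‖ + 1 : ℝ) : ℂ)‖ = ‖w‖ + 1 := by
      rw [Complex.norm_real, Real.norm_of_nonneg (by positivity)]
    have h2 : Summable fun n => ((‖w‖ + 1 : ℝ) : ℂ) ^ m * LSeries.term (PP f k m) s n :=
      (Summable.of_nonneg_of_le (fun _ => norm_nonneg _)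
        (fun n => term_bound f _ s σ (by rw [hw]; exact hs) k m n)
        (norm_term_pow f σ hσ (k + m)).1).of_norm
    rwa [summable_mul_left_iff] at h2
    refine pow_ne_zero _ ?_
    rw [← norm_ne_zero_iff, hw]
    positivity
  refine ⟨σ + (‖w‖ + 1), fun s hs => (main_sum f h1 w s (hS s hs) x bx (hb' x bx hbx)).1,
    fun s hs => ?_⟩
  have hg := (main_sum f h1 w s (hS s hs) 0 b (hb' 0 b (by simpa using hb))).2
  rw [tsum_eq_single 0 (by intro k hk; simp [hk])] at hg
  simp only [pow_zero, zero_add, Nat.factorial_one, Nat.cast_one, div_one, one_mul] at hg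
  have hV := V_pow f w s (hS s hs) (hL s hs)
  rw [← hg] at hV
  rw [(main_sum f h1 w s (hS s hs) x bx (hb' x bx hbx)).2]
  set g := DSeries b s
  have he := NormedSpace.expSeries_div_hasSum_exp (x * g)
  rw [← Complex.exp_eq_exp_ℂ] at he
  rw [← he.tsum_eq, he.summable.tsum_eq_zero_add, ← tsum_mul_left]
  congr 1
  · simp
  · refine tsum_congr fun k => ?_
    rw [hV]
    ring
end

section
/- Let f(s) = ∑_{n≥2} c_n n^{−s} be a Dirichlet series with zero constant term, nonnegative real coefficients c_n ≥ 0 (not all zero), converging absolutely in some half-plane, and with finite abscissa of absolute convergence σ_a^f > −∞. Fix w > 0 and let g(s) = ∑_{n≥2} b_n n^{−s} be the unique Dirichlet series with zero constant term, absolutely convergent in some half-plane, satisfying f(s − w·g(s)) = g(s) for all Re(s) sufficiently large. Then all coefficients b_n are nonnegative real numbers and the abscissa of absolute convergence of g equals σ_a^g = min_{s ≥ σ_a^f} ( s + w·f(s) ), where f(σ_a^f) is interpreted as the (possibly infinite) limit f(σ_a^f+). -/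
open scoped ENNReal ComplexOrder

namespace Aux18

/-- The weight `n^{-σ}`, set to zero at `n = 0`. -/
noncomputable def v (σ : ℝ) (n : ℕ) : ℝ := if n = 0 then 0 else (n : ℝ) ^ (-σ)

lemma v_zero (σ : ℝ) : v σ 0 = 0 := by simp [v]
lemma v_one (σ : ℝ) : v σ 1 = 1 := by simp [v]
lemma v_nonneg (σ : ℝ) (n : ℕ) : 0 ≤ v σ n := by
  unfold v; split_ifs <;> positivity
lemma v_pos (σ : ℝ) {n : ℕ} (hn : n ≠ 0) : 0 < v σ n := by
  have : (0:ℝ) < n := by positivity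
  simp only [v, hn, if_false]; positivity
lemma v_mul (σ : ℝ) (m n : ℕ) : v σ (m * n) = v σ m * v σ n := by
  unfold v
  by_cases hm : m = 0
  · simp [hm]
  by_cases hn : n = 0
  · simp [hn]
  simp [hm, hn, Real.mul_rpow]

lemma v_anti {σ τ : ℝ} (h : σ ≤ τ) (n : ℕ) : v τ n ≤ v σ n := by
  unfold v
  split_ifs with hn
  · exact le_rfl
  · apply Real.rpow_le_rpow_of_exponent_le
    · exact_mod_cast Nat.one_le_iff_ne_zero.mpr hn
    · linarith

lemma v_shift (σ y : ℝ) {n : ℕ} (hn : n ≠ 0) :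
    v σ n * Real.exp (Real.log n * y) = (n : ℝ) ^ (-(σ - y)) := by
  have : (0:ℝ) < n := by positivity
  simp only [v, hn, if_false]
  rw [← Real.rpow_def_of_pos this, ← Real.rpow_add this]
  congr 1; ring

lemma conv_tsum (X Y u : ℕ → ℝ≥0∞) (hu0 : u 0 = 0) :
    ∑' m, (∑ p ∈ m.divisorsAntidiagonal, X p.1 * Y p.2) * u m
      = ∑' p : ℕ × ℕ, X p.1 * Y p.2 * u (p.1 * p.2) := by
  rw [← ENNReal.tsum_fiberwise _ (fun p : ℕ × ℕ => p.1 * p.2)]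
  refine tsum_congr fun m => ?_
  rcases eq_or_ne m 0 with rfl | hm
  · simp only [Nat.divisorsAntidiagonal_zero, Finset.sum_empty, zero_mul]
    symm
    rw [ENNReal.tsum_eq_zero]
    rintro ⟨p, hp⟩
    have hp' : p.1 * p.2 = 0 := hp
    simp [hp', hu0]
  · have hs : ((fun p : ℕ × ℕ => p.1 * p.2) ⁻¹' {m}) = (m.divisorsAntidiagonal : Set (ℕ × ℕ)) := by
      ext p; simp [hm]
    rw [hs, Finset.tsum_subtype' m.divisorsAntidiagonal
      (fun p : ℕ × ℕ => X p.1 * Y p.2 * u (p.1 * p.2)), Finset.sum_mul]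
    refine Finset.sum_congr rfl fun p hp => ?_
    rw [(Nat.mem_divisorsAntidiagonal.mp hp).1]

lemma pow_le (b : ArithmeticFunction ℂ) (u : ℕ → ℝ≥0∞) (hu0 : u 0 = 0) (hu1 : u 1 ≤ 1)
    (hmul : ∀ d e, u (d * e) ≤ u d * u e) (k : ℕ) :
    ∑' m, ‖(b ^ k) m‖ₑ * u m ≤ (∑' m, ‖b m‖ₑ * u m) ^ k := by
  induction k with
  | zero =>
    rw [tsum_eq_single 1]
    · simpa using hu1
    · intro m hm; simp [hm]
  | succ k ih =>
    calc ∑' m, ‖(b ^ (k+1)) m‖ₑ * u m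
        ≤ ∑' m, (∑ p ∈ m.divisorsAntidiagonal, ‖(b ^ k) p.1‖ₑ * ‖b p.2‖ₑ) * u m := by
          gcongr with m
          rw [pow_succ, ArithmeticFunction.mul_apply]
          refine (enorm_sum_le _ _).trans ?_
          simp [enorm_mul]
      _ = ∑' p : ℕ × ℕ, ‖(b ^ k) p.1‖ₑ * ‖b p.2‖ₑ * u (p.1 * p.2) :=
          conv_tsum (fun m => ‖(b ^ k) m‖ₑ) (fun m => ‖b m‖ₑ) u hu0
      _ ≤ ∑' p : ℕ × ℕ, (‖(b ^ k) p.1‖ₑ * u p.1) * (‖b p.2‖ₑ * u p.2) := by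
          refine ENNReal.tsum_le_tsum fun p => ?_
          calc _ ≤ ‖(b ^ k) p.1‖ₑ * ‖b p.2‖ₑ * (u p.1 * u p.2) := by gcongr; exact hmul _ _
            _ = _ := by ring
      _ = (∑' m, ‖(b ^ k) m‖ₑ * u m) * (∑' m, ‖b m‖ₑ * u m) := by
          rw [ENNReal.tsum_prod (f := fun m n => (‖(b ^ k) m‖ₑ * u m) * (‖b n‖ₑ * u n))]
          simp_rw [ENNReal.tsum_mul_left, ENNReal.tsum_mul_right]
      _ ≤ _ := by rw [pow_succ]; gcongr

lemma pow_nonneg_of (b : ArithmeticFunction ℂ) (j : ℕ) (h : ∀ i ≤ j, 0 ≤ b i) (k : ℕ) :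
    ∀ i ≤ j, 0 ≤ (b ^ k) i := by
  induction k with
  | zero =>
    intro i _
    rw [pow_zero, ArithmeticFunction.one_apply]
    split_ifs <;> simp
  | succ k ih =>
    intro i hi
    rw [pow_succ, ArithmeticFunction.mul_apply]
    refine Finset.sum_nonneg fun p hp => ?_
    have h1 := Nat.mem_divisorsAntidiagonal.mp hp
    have hi0 : 0 < i := Nat.pos_of_ne_zero h1.2
    have d1 : p.1 ≤ i := Nat.le_of_dvd hi0 ⟨p.2, h1.1.symm⟩
    have d2 : p.2 ≤ i := Nat.le_of_dvd hi0 ⟨p.1, by rw [mul_comm]; exact h1.1.symm⟩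
    exact mul_nonneg (ih _ (d1.trans hi)) (h _ (d2.trans hi))

lemma enorm_of_nonneg {z : ℂ} (hz : 0 ≤ z) : ‖z‖ₑ = ENNReal.ofReal z.re := by
  obtain ⟨h1, h2⟩ := Complex.nonneg_iff.mp hz
  have h3 : z = (z.re : ℂ) := Complex.ext (by simp) (by simpa using h2.symm)
  rw [← ofReal_norm]
  conv_lhs => rw [h3]
  rw [Complex.norm_real, Real.norm_of_nonneg h1]

lemma enorm_sum_nonneg {ι : Type*} (s : Finset ι) (f : ι → ℂ) (hf : ∀ i ∈ s, 0 ≤ f i) :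
    ‖∑ i ∈ s, f i‖ₑ = ∑ i ∈ s, ‖f i‖ₑ := by
  rw [enorm_of_nonneg (Finset.sum_nonneg hf), Complex.re_sum, ENNReal.ofReal_sum_of_nonneg]
  · exact Finset.sum_congr rfl fun i hi => (enorm_of_nonneg (hf i hi)).symm
  · intro i hi; exact (Complex.nonneg_iff.mp (hf i hi)).1

lemma enorm_tsum_nonneg {ι : Type*} (f : ι → ℂ) (hf : ∀ i, 0 ≤ f i) (hs : Summable f) :
    ‖∑' i, f i‖ₑ = ∑' i, ‖f i‖ₑ := by
  rw [enorm_of_nonneg (tsum_nonneg hf), Complex.re_tsum hs, ENNReal.ofReal_tsum_of_nonneg]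
  · exact tsum_congr fun i => (enorm_of_nonneg (hf i)).symm
  · intro i; exact (Complex.nonneg_iff.mp (hf i)).1
  · exact (Complex.hasSum_re hs.hasSum).summable

lemma pow_ge (b : ArithmeticFunction ℂ) (hb : ∀ n, 0 ≤ b n) (u : ℕ → ℝ≥0∞) (hu0 : u 0 = 0)
    (hu1 : 1 ≤ u 1) (hmul : ∀ d e, u d * u e ≤ u (d * e)) (k : ℕ) :
    (∑' m, ‖b m‖ₑ * u m) ^ k ≤ ∑' m, ‖(b ^ k) m‖ₑ * u m := by
  induction k with
  | zero =>
    refine le_trans ?_ (ENNReal.le_tsum 1)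
    simpa using hu1
  | succ k ih =>
    calc (∑' m, ‖b m‖ₑ * u m) ^ (k+1)
        ≤ (∑' m, ‖(b ^ k) m‖ₑ * u m) * (∑' m, ‖b m‖ₑ * u m) := by rw [pow_succ]; gcongr
      _ = ∑' p : ℕ × ℕ, (‖(b ^ k) p.1‖ₑ * u p.1) * (‖b p.2‖ₑ * u p.2) := by
          rw [ENNReal.tsum_prod (f := fun m n => (‖(b ^ k) m‖ₑ * u m) * (‖b n‖ₑ * u n))]
          simp_rw [ENNReal.tsum_mul_left, ENNReal.tsum_mul_right]
      _ ≤ ∑' p : ℕ × ℕ, ‖(b ^ k) p.1‖ₑ * ‖b p.2‖ₑ * u (p.1 * p.2) := by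
          refine ENNReal.tsum_le_tsum fun p => ?_
          calc _ = ‖(b ^ k) p.1‖ₑ * ‖b p.2‖ₑ * (u p.1 * u p.2) := by ring
            _ ≤ _ := by gcongr; exact hmul _ _
      _ = ∑' m, (∑ p ∈ m.divisorsAntidiagonal, ‖(b ^ k) p.1‖ₑ * ‖b p.2‖ₑ) * u m :=
          (conv_tsum (fun m => ‖(b ^ k) m‖ₑ) (fun m => ‖b m‖ₑ) u hu0).symm
      _ ≤ ∑' m, ‖(b ^ (k+1)) m‖ₑ * u m := by
          gcongr with m
          rw [pow_succ, ArithmeticFunction.mul_apply, enorm_sum_nonneg]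
          · simp [enorm_mul]
          · intro p _
            exact mul_nonneg (pow_nonneg_of b p.1 (fun i _ => hb i) k _ le_rfl) (hb _)

lemma exp_tsum (x : ℝ) (hx : 0 ≤ x) (S : ℝ≥0∞) (hS : S ≠ ⊤) :
    ∑' k : ℕ, ENNReal.ofReal (x ^ k / (k.factorial : ℝ)) * S ^ k
      = ENNReal.ofReal (Real.exp (x * S.toReal)) := by
  have h : HasSum (fun k : ℕ => (x * S.toReal) ^ k / (k.factorial : ℝ))
      (Real.exp (x * S.toReal)) := by
    rw [Real.exp_eq_exp_ℝ]
    exact NormedSpace.expSeries_div_hasSum_exp _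
  rw [← h.tsum_eq, ENNReal.ofReal_tsum_of_nonneg _ h.summable]
  · refine tsum_congr fun k => ?_
    conv_lhs => rw [← ENNReal.ofReal_toReal hS, ← ENNReal.ofReal_pow ENNReal.toReal_nonneg,
      ← ENNReal.ofReal_mul (by positivity)]
    congr 1
    rw [mul_pow]; ring
  · intro k
    have := ENNReal.toReal_nonneg (a := S)
    positivity

/-- The coefficient attached to the index `(n, k, j)`. -/
noncomputable def tau (c : ℕ → ℝ) (w : ℝ) (b : ArithmeticFunction ℂ) (p : ℕ × ℕ × ℕ) : ℂ :=
  ((c p.1 * ((w * Real.log p.1) ^ p.2.1 / (p.2.1.factorial : ℝ)) : ℝ) : ℂ) * (b ^ p.2.1) p.2.2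

lemma x_nonneg {w : ℝ} (hw : 0 < w) (n : ℕ) : 0 ≤ w * Real.log n :=
  mul_nonneg hw.le (Real.log_natCast_nonneg n)

lemma tau_enorm (c : ℕ → ℝ) (hc : ∀ n, 0 ≤ c n) (w : ℝ) (hw : 0 < w) (b : ArithmeticFunction ℂ)
    (p : ℕ × ℕ × ℕ) : ‖tau c w b p‖ₑ = ENNReal.ofReal (c p.1) *
      (ENNReal.ofReal ((w * Real.log p.1) ^ p.2.1 / (p.2.1.factorial : ℝ)) *
        ‖(b ^ p.2.1) p.2.2‖ₑ) := by
  have h1 := x_nonneg hw p.1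
  have h2 := hc p.1
  rw [tau, enorm_mul, ← ofReal_norm (Complex.ofReal _), Complex.norm_real,
    Real.norm_of_nonneg (by positivity), ENNReal.ofReal_mul h2, mul_assoc]

lemma triple (c : ℕ → ℝ) (hc : ∀ n, 0 ≤ c n) (w : ℝ) (hw : 0 < w) (b : ArithmeticFunction ℂ)
    (U V : ℕ → ℝ≥0∞) :
    ∑' p : ℕ × ℕ × ℕ, ‖tau c w b p‖ₑ * (U p.1 * V p.2.2) =
      ∑' n, ENNReal.ofReal (c n) * U n *
        ∑' k : ℕ, ENNReal.ofReal ((w * Real.log n) ^ k / (k.factorial : ℝ)) *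
          ∑' j, ‖(b ^ k) j‖ₑ * V j := by
  rw [ENNReal.tsum_prod (f := fun (n : ℕ) (q : ℕ × ℕ) => ‖tau c w b (n, q)‖ₑ * (U n * V q.2))]
  refine tsum_congr fun n => ?_
  rw [ENNReal.tsum_prod (f := fun (k j : ℕ) => ‖tau c w b (n, k, j)‖ₑ * (U n * V j)), ← ENNReal.tsum_mul_left]
  refine tsum_congr fun k => ?_
  rw [← ENNReal.tsum_mul_left, ← ENNReal.tsum_mul_left]
  refine tsum_congr fun j => ?_
  rw [tau_enorm c hc w hw]
  ring

/-- ENNReal version of `f(σ - w S)`. -/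
lemma fval (c : ℕ → ℝ) (hc : ∀ n, 0 ≤ c n) (hc0 : c 0 = 0) (w σ : ℝ) (hw : 0 < w)
    (S : ℝ≥0∞) (hS : S ≠ ⊤) :
    ∑' n, ENNReal.ofReal (c n) * ENNReal.ofReal (v σ n) *
        ∑' k : ℕ, ENNReal.ofReal ((w * Real.log n) ^ k / (k.factorial : ℝ)) * S ^ k
      = ∑' n : ℕ, ENNReal.ofReal (c n * (n : ℝ) ^ (-(σ - w * S.toReal))) := by
  refine tsum_congr fun n => ?_
  rw [exp_tsum _ (x_nonneg hw n) S hS]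
  rcases eq_or_ne n 0 with rfl | hn
  · simp [hc0]
  · rw [← ENNReal.ofReal_mul (hc n), ← ENNReal.ofReal_mul (mul_nonneg (hc n) (v_nonneg _ _)),
      mul_assoc, ← v_shift σ (w * S.toReal) hn]
    congr 4; ring

lemma triple_le (c : ℕ → ℝ) (hc : ∀ n, 0 ≤ c n) (hc0 : c 0 = 0) (w σ : ℝ) (hw : 0 < w)
    (b : ArithmeticFunction ℂ) (u : ℕ → ℝ≥0∞) (hu0 : u 0 = 0) (hu1 : u 1 ≤ 1)
    (hmul : ∀ d e, u (d * e) ≤ u d * u e) (hS : ∑' m, ‖b m‖ₑ * u m ≠ ⊤) :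
    ∑' p : ℕ × ℕ × ℕ, ‖tau c w b p‖ₑ * (ENNReal.ofReal (v σ p.1) * u p.2.2) ≤
      ∑' n : ℕ, ENNReal.ofReal (c n * (n : ℝ) ^ (-(σ - w * (∑' m, ‖b m‖ₑ * u m).toReal))) := by
  rw [triple c hc w hw b (fun n => ENNReal.ofReal (v σ n)) u, ← fval c hc hc0 w σ hw _ hS]
  gcongr with n k
  exact pow_le b u hu0 hu1 hmul k

lemma triple_ge (c : ℕ → ℝ) (hc : ∀ n, 0 ≤ c n) (hc0 : c 0 = 0) (w σ : ℝ) (hw : 0 < w)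
    (b : ArithmeticFunction ℂ) (hb : ∀ n, 0 ≤ b n) (u : ℕ → ℝ≥0∞) (hu0 : u 0 = 0) (hu1 : 1 ≤ u 1)
    (hmul : ∀ d e, u d * u e ≤ u (d * e)) (hS : ∑' m, ‖b m‖ₑ * u m ≠ ⊤) :
    ∑' n : ℕ, ENNReal.ofReal (c n * (n : ℝ) ^ (-(σ - w * (∑' m, ‖b m‖ₑ * u m).toReal))) ≤
    ∑' p : ℕ × ℕ × ℕ, ‖tau c w b p‖ₑ * (ENNReal.ofReal (v σ p.1) * u p.2.2) := by
  rw [triple c hc w hw b (fun n => ENNReal.ofReal (v σ n)) u, ← fval c hc hc0 w σ hw _ hS]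
  gcongr with n k
  exact pow_ge b hb u hu0 hu1 hmul k

lemma term_eq (f : ℕ → ℂ) (σ : ℝ) (n : ℕ) : LSeries.term f σ n = f n * (v σ n : ℂ) := by
  rcases eq_or_ne n 0 with rfl | hn
  · simp [v]
  · rw [LSeries.term_of_ne_zero hn]
    simp only [v, hn, if_false]
    rw [Complex.ofReal_cpow (by positivity), div_eq_mul_inv, ← Complex.cpow_neg]
    simp

lemma enorm_v (σ : ℝ) (n : ℕ) : ‖(v σ n : ℂ)‖ₑ = ENNReal.ofReal (v σ n) := by
  rw [← ofReal_norm, Complex.norm_real, Real.norm_of_nonneg (v_nonneg _ _)]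

lemma lsum_of (f : ℕ → ℂ) (σ : ℝ) (h : ∑' m, ‖f m‖ₑ * ENNReal.ofReal (v σ m) ≠ ⊤) :
    LSeriesSummable f σ := by
  have : Summable (fun n => ‖f n * (v σ n : ℂ)‖) := by
    rw [← tsum_enorm_ne_top_iff_summable_norm]
    simpa [enorm_mul, enorm_v] using h
  simpa only [LSeriesSummable, funext (term_eq f σ)] using this.of_norm

lemma lpow (b : ArithmeticFunction ℂ) (s : ℂ) (h : LSeriesSummable (fun n => b n) s) (k : ℕ) :
    LSeriesHasSum (fun n => (b ^ k) n) s (LSeries (fun n => b n) s ^ k) := by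
  induction k with
  | zero =>
    have h1 : (fun n => (b ^ 0) n) = LSeries.delta := by
      rw [pow_zero]; exact ArithmeticFunction.one_eq_delta
    rw [h1, pow_zero, LSeriesHasSum]
    have := hasSum_single (f := LSeries.term LSeries.delta s) 1 (by
      intro n hn; simp [LSeries.term_delta, hn])
    simpa [LSeries.term_delta, LSeries.delta] using this
  | succ k ih =>
    have := ArithmeticFunction.LSeriesHasSum_mul ih h.LSeriesHasSum
    rw [pow_succ, pow_succ]; exact this

lemma sumT (c : ℕ → ℝ) (hc : ∀ n, 0 ≤ c n) (hc0 : c 0 = 0) (w σ : ℝ) (hw : 0 < w)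
    (b : ArithmeticFunction ℂ)
    (hS : ∑' m, ‖b m‖ₑ * ENNReal.ofReal (v σ m) ≠ ⊤)
    (hf : Summable fun n : ℕ =>
      c n * (n : ℝ) ^ (-(σ - w * (∑' m, ‖b m‖ₑ * ENNReal.ofReal (v σ m)).toReal)))
    (heq : DSeries (fun n => (c n : ℂ)) (σ - (w : ℂ) * LSeries (fun n => b n) σ)
      = LSeries (fun n => b n) σ) :
    HasSum (fun p : ℕ × ℕ × ℕ => tau c w b p * (v σ (p.1 * p.2.2) : ℂ))
      (LSeries (fun n => b n) σ) := by
  have hsum : Summable (fun p : ℕ × ℕ × ℕ => tau c w b p * (v σ (p.1 * p.2.2) : ℂ)) := by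
    apply Summable.of_norm
    rw [← tsum_enorm_ne_top_iff_summable_norm]
    have h1 := triple_le c hc hc0 w σ hw b (fun m => ENNReal.ofReal (v σ m)) (by simp [v_zero])
      (by simp [v_one]) (fun d e => by rw [v_mul, ENNReal.ofReal_mul (v_nonneg _ _)]) hS
    refine ne_top_of_le_ne_top ?_ (le_trans (le_of_eq (tsum_congr fun p => ?_)) h1)
    · rw [← ENNReal.ofReal_tsum_of_nonneg _ hf]
      · exact ENNReal.ofReal_ne_top
      · intro n; have := hc n; positivity
    · rw [enorm_mul, enorm_v, v_mul, ENNReal.ofReal_mul (v_nonneg _ _)]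
  have hL := lsum_of (fun n => b n) σ hS
  set g := LSeries (fun n => b n) σ with hg
  have h2 : ∑' p : ℕ × ℕ × ℕ, tau c w b p * (v σ (p.1 * p.2.2) : ℂ) = g := by
    rw [hsum.tsum_prod]
    rw [← heq, DSeries]
    refine tsum_congr fun n => ?_
    rw [(hsum.prod_factor n).tsum_prod]
    have hk : ∀ k : ℕ, ∑' j, tau c w b (n, k, j) * (v σ (n * j) : ℂ) =
        (c n * v σ n : ℂ) * (((w * Real.log n : ℝ) * g) ^ k / (k.factorial : ℂ)) := by
      intro k
      have h3 : HasSum _ _ := lpow b σ hL k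
      rw [funext (term_eq _ σ)] at h3
      have h4 := (h3.mul_left
        ((c n * v σ n : ℂ) * ((w * Real.log n : ℝ) ^ k / (k.factorial : ℂ)))).tsum_eq
      rw [← hg] at h4
      rw [mul_pow, mul_div_right_comm, ← mul_assoc, ← h4]
      refine tsum_congr fun j => ?_
      rw [tau, v_mul]; push_cast; ring
    simp_rw [hk]
    rw [tsum_mul_left]
    have h5 := NormedSpace.expSeries_div_hasSum_exp (((w * Real.log n : ℝ) : ℂ) * g)
    rw [h5.tsum_eq, ← Complex.exp_eq_exp_ℂ]
    rcases eq_or_ne n 0 with rfl | hn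
    · simp [hc0]
    · have hn' : (n : ℂ) ≠ 0 := by exact_mod_cast hn
      simp only [v, hn, if_false]
      rw [Complex.ofReal_cpow (by positivity), mul_assoc]
      congr 1
      rw [neg_sub, sub_eq_neg_add, Complex.cpow_add _ _ hn']
      congr 1
      · simp
      · rw [Complex.cpow_def_of_ne_zero hn']
        congr 1
        push_cast [Complex.ofReal_log, Complex.natCast_log]
        ring
  rw [← h2]; exact hsum.hasSum

/-- The index map `(n, k, j) ↦ n j`. -/
def pr (p : ℕ × ℕ × ℕ) : ℕ := p.1 * p.2.2

lemma key (c : ℕ → ℝ) (w : ℝ) (b : ArithmeticFunction ℂ) (Θ : ℝ)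
    (hb : LSeriesSummable (fun n => b n) Θ)
    (h : ∀ σ : ℝ, Θ ≤ σ → HasSum (fun p : ℕ × ℕ × ℕ => tau c w b p * (v σ (p.1 * p.2.2) : ℂ))
      (LSeries (fun n => b n) σ)) (m : ℕ) (hm : m ≠ 0) :
    Summable (fun p : pr ⁻¹' {m} => tau c w b p) ∧ ∑' p : pr ⁻¹' {m}, tau c w b p = b m := by
  constructor
  · have h1 := (h Θ le_rfl).summable.subtype (pr ⁻¹' {m})
    have hv : (v Θ m : ℂ) ≠ 0 := by exact_mod_cast (v_pos Θ hm).ne'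
    rw [← summable_mul_right_iff hv]
    refine h1.congr ?_
    rintro ⟨p, hp⟩
    have hp' : p.1 * p.2.2 = m := hp
    simp [hp']
  · set a : ℕ → ℂ := fun m => ∑' p : pr ⁻¹' {m}, tau c w b p with ha
    have hfib : ∀ σ : ℝ, Θ ≤ σ → LSeriesHasSum a σ (LSeries (fun n => b n) σ) := by
      intro σ hσ
      have h1 := (h σ hσ).tsum_fiberwise pr
      rw [LSeriesHasSum, funext (term_eq a σ)]
      refine (congrArg (fun q => HasSum q (LSeries (fun n => b n) σ)) (funext fun m => ?_)).mpr h1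
      rw [ha, ← tsum_mul_right]
      refine tsum_congr ?_
      rintro ⟨p, hp⟩
      have hp' : p.1 * p.2.2 = m := hp
      simp [hp']
    have h2 : ∀ n ≠ 0, a n = b n := by
      intro n hn
      refine LSeries.eq_of_LSeries_eventually_eq (f := a) (g := fun n => b n) ?_ ?_ ?_ hn
      · exact lt_of_le_of_lt (hfib Θ le_rfl).LSeriesSummable.abscissaOfAbsConv_le
          (EReal.coe_lt_top _)
      · exact lt_of_le_of_lt hb.abscissaOfAbsConv_le (EReal.coe_lt_top _)
      · filter_upwards [Filter.eventually_ge_atTop Θ] with σ hσ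
        exact (hfib σ hσ).LSeries_eq
    exact h2 m hm

lemma b_nonneg (c : ℕ → ℝ) (hc : ∀ n, 0 ≤ c n) (hc0 : c 0 = 0) (hc1 : c 1 = 0) (w : ℝ)
    (hw : 0 < w) (b : ArithmeticFunction ℂ)
    (h : ∀ m ≠ 0, ∑' p : pr ⁻¹' {m}, tau c w b p = b m) (m : ℕ) : 0 ≤ b m := by
  induction m using Nat.strong_induction_on with
  | _ m ih =>
    rcases eq_or_ne m 0 with rfl | hm
    · simp
    rw [← h m hm]
    refine tsum_nonneg ?_
    rintro ⟨⟨n, k, j⟩, hp⟩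
    have hp' : n * j = m := hp
    have hx := x_nonneg hw n
    have hcn := hc n
    simp only [tau]
    rcases Nat.lt_or_ge n 2 with hn | hn
    · interval_cases n <;> simp [hc0, hc1]
    · have hj0 : j ≠ 0 := by rintro rfl; simp at hp'; omega
      have hj : j < m := by nlinarith [Nat.pos_of_ne_zero hj0]
      refine mul_nonneg ?_ (pow_nonneg_of b j (fun i hi => ih i (by omega)) k j le_rfl)
      rw [Complex.zero_le_real]
      positivity

lemma b_enorm_sum (c : ℕ → ℝ) (hc : ∀ n, 0 ≤ c n) (w : ℝ)
    (hw : 0 < w) (b : ArithmeticFunction ℂ) (hb : ∀ m, 0 ≤ b m)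
    (h : ∀ m ≠ 0, Summable (fun p : pr ⁻¹' {m} => tau c w b p) ∧
      ∑' p : pr ⁻¹' {m}, tau c w b p = b m) (u : ℕ → ℝ≥0∞) (hu0 : u 0 = 0) :
    ∑' m, ‖b m‖ₑ * u m = ∑' p : ℕ × ℕ × ℕ, ‖tau c w b p‖ₑ * u (p.1 * p.2.2) := by
  rw [← ENNReal.tsum_fiberwise _ pr]
  refine tsum_congr fun m => ?_
  have h1 : ∀ p : pr ⁻¹' {m}, ‖tau c w b p‖ₑ * u (p.1.1 * p.1.2.2) = ‖tau c w b p‖ₑ * u m := by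
    rintro ⟨p, hp⟩
    have hp' : p.1 * p.2.2 = m := hp
    simp [hp']
  rw [tsum_congr h1, ENNReal.tsum_mul_right]
  rcases eq_or_ne m 0 with rfl | hm
  · simp [hu0]
  congr 1
  rw [← (h m hm).2]
  refine enorm_tsum_nonneg _ ?_ (h m hm).1
  rintro ⟨⟨n, k, j⟩, hp⟩
  have hx := x_nonneg hw n
  have hcn := hc n
  refine mul_nonneg ?_ (pow_nonneg_of b j (fun i _ => hb i) k j le_rfl)
  rw [Complex.zero_le_real]
  positivity

lemma upper (c : ℕ → ℝ) (hc : ∀ n, 0 ≤ c n) (hc0 : c 0 = 0) (hc1 : c 1 = 0) (w : ℝ)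
    (hw : 0 < w) (b : ArithmeticFunction ℂ)
    (hid : ∀ u : ℕ → ℝ≥0∞, u 0 = 0 →
      ∑' m, ‖b m‖ₑ * u m = ∑' p : ℕ × ℕ × ℕ, ‖tau c w b p‖ₑ * u (p.1 * p.2.2))
    (t σ : ℝ) (ht : Summable fun n : ℕ => c n * (n : ℝ) ^ (-t))
    (hσ : t + w * ∑' n : ℕ, c n * (n : ℝ) ^ (-t) ≤ σ) :
    ∑' m, ‖b m‖ₑ * ENNReal.ofReal (v σ m) ≠ ⊤ := by
  have hnn : ∀ (r : ℝ) (n : ℕ), 0 ≤ c n * (n : ℝ) ^ (-r) := fun r n => by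
    have := hc n; positivity
  set F := ∑' n : ℕ, c n * (n : ℝ) ^ (-t) with hF
  have hF0 : 0 ≤ F := tsum_nonneg (hnn t)
  let u : ℕ → ℕ → ℝ≥0∞ := fun N m => if m ≤ N then ENNReal.ofReal (v σ m) else 0
  have hu0 : ∀ N, u N 0 = 0 := fun N => by simp [u, v_zero]
  have hmulv : ∀ d e, ENNReal.ofReal (v σ (d * e))
      = ENNReal.ofReal (v σ d) * ENNReal.ofReal (v σ e) := fun d e => by
    rw [v_mul, ENNReal.ofReal_mul (v_nonneg _ _)]
  have hu : ∀ N, ∑' m, ‖b m‖ₑ * u N m ≤ ENNReal.ofReal F := by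
    intro N
    induction N with
    | zero =>
      have : ∀ m, ‖b m‖ₑ * u 0 m = 0 := by
        intro m
        rcases eq_or_ne m 0 with rfl | hm
        · simp [hu0]
        · simp [u, hm]
      simp [this]
    | succ N ih =>
      have hfin : ∑' m, ‖b m‖ₑ * u N m ≠ ⊤ := ne_top_of_le_ne_top ENNReal.ofReal_ne_top ih
      have hSF : (∑' m, ‖b m‖ₑ * u N m).toReal ≤ F := ENNReal.toReal_le_of_le_ofReal hF0 ih
      calc ∑' m, ‖b m‖ₑ * u (N+1) m
          = ∑' p : ℕ × ℕ × ℕ, ‖tau c w b p‖ₑ * u (N+1) (p.1 * p.2.2) := hid _ (hu0 _)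
        _ ≤ ∑' p : ℕ × ℕ × ℕ, ‖tau c w b p‖ₑ * (ENNReal.ofReal (v σ p.1) * u N p.2.2) := by
          refine ENNReal.tsum_le_tsum ?_
          rintro ⟨n, k, j⟩
          rcases Nat.lt_or_ge n 2 with hn | hn
          · interval_cases n <;> simp [tau, hc0, hc1]
          · gcongr
            simp only [u]
            split_ifs with h1 h2
            · rw [hmulv]
            · exfalso; nlinarith
            · simp
            · simp
        _ ≤ ∑' n : ℕ, ENNReal.ofReal
              (c n * (n : ℝ) ^ (-(σ - w * (∑' m, ‖b m‖ₑ * u N m).toReal))) := by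
          refine triple_le c hc hc0 w σ hw b (u N) (hu0 N) ?_ ?_ hfin
          · simp only [u]; split_ifs <;> simp [v_one]
          · intro d e
            rcases eq_or_ne d 0 with rfl | hd
            · simp [hu0]
            rcases eq_or_ne e 0 with rfl | he
            · simp [hu0]
            have h1 : d ≤ d * e := Nat.le_mul_of_pos_right _ (Nat.pos_of_ne_zero he)
            have h2 : e ≤ d * e := Nat.le_mul_of_pos_left _ (Nat.pos_of_ne_zero hd)
            by_cases h3 : d * e ≤ N
            · simp only [u, h3, h1.trans h3, h2.trans h3, if_true]
              rw [hmulv]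
            · simp [u, h3]
        _ ≤ ∑' n : ℕ, ENNReal.ofReal (c n * (n : ℝ) ^ (-t)) := by
          refine ENNReal.tsum_le_tsum fun n => ENNReal.ofReal_le_ofReal ?_
          rcases eq_or_ne n 0 with rfl | hn
          · simp [hc0]
          refine mul_le_mul_of_nonneg_left ?_ (hc n)
          refine Real.rpow_le_rpow_of_exponent_le
            (by exact_mod_cast Nat.one_le_iff_ne_zero.mpr hn) ?_
          nlinarith
        _ = ENNReal.ofReal F := by rw [hF, ENNReal.ofReal_tsum_of_nonneg (hnn t) ht]
  refine ne_top_of_le_ne_top (ENNReal.ofReal_ne_top (r := F)) ?_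
  rw [ENNReal.tsum_eq_iSup_nat]
  refine iSup_le fun N => ?_
  refine le_trans ?_ (hu N)
  refine le_trans ?_ (ENNReal.sum_le_tsum (Finset.range N))
  refine Finset.sum_le_sum fun m hm => ?_
  simp [u, (Finset.mem_range.mp hm).le]

lemma lower (c : ℕ → ℝ) (hc : ∀ n, 0 ≤ c n) (hc0 : c 0 = 0) (w : ℝ)
    (hw : 0 < w) (b : ArithmeticFunction ℂ) (hb : ∀ m, 0 ≤ b m)
    (hid : ∀ u : ℕ → ℝ≥0∞, u 0 = 0 →
      ∑' m, ‖b m‖ₑ * u m = ∑' p : ℕ × ℕ × ℕ, ‖tau c w b p‖ₑ * u (p.1 * p.2.2))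
    (σ : ℝ) (hS : ∑' m, ‖b m‖ₑ * ENNReal.ofReal (v σ m) ≠ ⊤) :
    ∃ t, (Summable fun n : ℕ => c n * (n : ℝ) ^ (-t)) ∧
      t + w * ∑' n : ℕ, c n * (n : ℝ) ^ (-t) ≤ σ := by
  have hnn : ∀ (r : ℝ) (n : ℕ), 0 ≤ c n * (n : ℝ) ^ (-r) := fun r n => by
    have := hc n; positivity
  have hmulv : ∀ d e, ENNReal.ofReal (v σ (d * e))
      = ENNReal.ofReal (v σ d) * ENNReal.ofReal (v σ e) := fun d e => by
    rw [v_mul, ENNReal.ofReal_mul (v_nonneg _ _)]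
  have h1 := triple_ge c hc hc0 w σ hw b hb (fun m => ENNReal.ofReal (v σ m)) (by simp [v_zero])
    (by simp [v_one]) (fun d e => (hmulv d e).ge) hS
  have h2 := hid (fun m => ENNReal.ofReal (v σ m)) (by simp [v_zero])
  simp only [hmulv] at h2
  rw [← h2] at h1
  set S := ∑' m, ‖b m‖ₑ * ENNReal.ofReal (v σ m) with hSdef
  refine ⟨σ - w * S.toReal, ?_, ?_⟩
  · have h3 := ne_top_of_le_ne_top hS h1
    have h4 := ENNReal.summable_toReal h3
    refine h4.congr fun n => ?_
    rw [ENNReal.toReal_ofReal (hnn _ _)]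
  · have h3 := ne_top_of_le_ne_top hS h1
    have h4 := ENNReal.summable_toReal h3
    have h5 : Summable fun n : ℕ => c n * (n : ℝ) ^ (-(σ - w * S.toReal)) := by
      refine h4.congr fun n => ?_
      rw [ENNReal.toReal_ofReal (hnn _ _)]
    rw [← ENNReal.ofReal_tsum_of_nonneg (hnn _) h5] at h1
    have h6 := (ENNReal.ofReal_le_iff_le_toReal hS).mp h1
    nlinarith

end Aux18

namespace Aux18

lemma summ_iff (b : ℕ → ℂ) (hb0 : b 0 = 0) (σ : ℝ) :
    (Summable fun n : ℕ => ‖b n‖ * (n : ℝ) ^ (-σ)) ↔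
      ∑' m, ‖b m‖ₑ * ENNReal.ofReal (v σ m) ≠ ⊤ := by
  have h : ∀ n, ‖b n‖ * (n : ℝ) ^ (-σ) = ‖b n * (v σ n : ℂ)‖ := by
    intro n
    rcases eq_or_ne n 0 with rfl | hn
    · simp [hb0]
    · rw [norm_mul, Complex.norm_real, Real.norm_of_nonneg (v_nonneg _ _)]
      simp [v, hn]
  simp_rw [h]
  rw [← tsum_enorm_ne_top_iff_summable_norm]
  simp [enorm_mul, enorm_v]

lemma summ_mono (c : ℕ → ℝ) (hc : ∀ n, 0 ≤ c n) (hc0 : c 0 = 0) {s t : ℝ} (h : s ≤ t)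
    (hs : Summable fun n : ℕ => c n * (n : ℝ) ^ (-s)) :
    (Summable fun n : ℕ => c n * (n : ℝ) ^ (-t)) ∧
      ∑' n : ℕ, c n * (n : ℝ) ^ (-t) ≤ ∑' n : ℕ, c n * (n : ℝ) ^ (-s) := by
  have hle : ∀ n : ℕ, c n * (n : ℝ) ^ (-t) ≤ c n * (n : ℝ) ^ (-s) := by
    intro n
    rcases eq_or_ne n 0 with rfl | hn
    · simp [hc0]
    refine mul_le_mul_of_nonneg_left ?_ (hc n)
    refine Real.rpow_le_rpow_of_exponent_le
      (by exact_mod_cast Nat.one_le_iff_ne_zero.mpr hn) ?_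
    linarith
  have h2 : Summable fun n : ℕ => c n * (n : ℝ) ^ (-t) :=
    Summable.of_nonneg_of_le (fun n => by have := hc n; positivity) hle hs
  exact ⟨h2, h2.tsum_le_tsum hle hs⟩

lemma dseries_eq (b : ℕ → ℂ) (hb0 : b 0 = 0) (s : ℂ) : DSeries b s = LSeries b s := by
  rw [DSeries, LSeries]
  refine tsum_congr fun n => ?_
  rcases eq_or_ne n 0 with rfl | hn
  · simp [hb0]
  · rw [LSeries.term_of_ne_zero hn, Complex.cpow_neg, div_eq_mul_inv]

end Aux18

theorem stmt_18 (c : ℕ → ℝ)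
    (hc0 : c 0 = 0) (hc1 : c 1 = 0)
    (hcpos : ∀ n, 0 ≤ c n) (hcne : ∃ n, c n ≠ 0)
    -- `f` converges absolutely in some half-plane:
    (hfconv : {σ : ℝ | Summable fun n : ℕ => c n * (n : ℝ) ^ (-σ)}.Nonempty)
    -- the abscissa of absolute convergence of `f` is finite (`σ_a^f > -∞`):
    (hffin : BddBelow {σ : ℝ | Summable fun n : ℕ => c n * (n : ℝ) ^ (-σ)})
    -- `σf` is the abscissa of absolute convergence of `f`:
    (σf : ℝ) (hσf : σf = sInf {σ : ℝ | Summable fun n : ℕ => c n * (n : ℝ) ^ (-σ)})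
    (w : ℝ) (hw : 0 < w)
    -- `g` is the solution of `f(s - w·g(s)) = g(s)`:
    (b : ℕ → ℂ) (hb0 : b 0 = 0) (hb1 : b 1 = 0)
    (hgconv : ∃ θ : ℝ, ∀ s : ℂ, θ < s.re → Summable fun n : ℕ => ‖b n * (n : ℂ) ^ (-s)‖)
    (heq : ∃ θ : ℝ, ∀ s : ℂ, θ < s.re →
      DSeries (fun n => (c n : ℂ)) (s - (w : ℂ) * DSeries b s) = DSeries b s)
    -- `σg` is the abscissa of absolute convergence of `g`:
    (σg : ℝ) (hσg : σg = sInf {σ : ℝ | Summable fun n : ℕ => ‖b n‖ * (n : ℝ) ^ (-σ)}) :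
    -- conclusion: all coefficients of `g` are nonnegative reals, and
    -- `σ_a^g = min_{s ≥ σ_a^f} (s + w·f(s))` where `f(σ_a^f)` is the right limit
    -- `f(σ_a^f+)` (for the convex function `s + w·f(s)` this minimum over `[σf, ∞)`
    -- equals the infimum over the open ray `(σf, ∞)`):
    (∀ n : ℕ, ∃ r : ℝ, 0 ≤ r ∧ b n = (r : ℂ)) ∧
      σg = sInf {y : ℝ | ∃ s : ℝ, σf < s ∧
        y = s + w * ∑' n : ℕ, c n * (n : ℝ) ^ (-s)} := by
  classical
  let B : ArithmeticFunction ℂ := ⟨b, hb0⟩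
  have hB : ∀ n, B n = b n := fun n => rfl
  obtain ⟨θ₁, hθ₁⟩ := hgconv
  obtain ⟨θ₂, hθ₂⟩ := heq
  obtain ⟨σ₀, hσ₀⟩ := hfconv
  have hσ₀' : Summable fun n : ℕ => c n * (n : ℝ) ^ (-σ₀) := hσ₀
  let S : ℝ → ℝ≥0∞ := fun σ => ∑' m, ‖B m‖ₑ * ENNReal.ofReal (Aux18.v σ m)
  have hS1 : S (θ₁ + 1) ≠ ⊤ := by
    refine (Aux18.summ_iff b hb0 (θ₁ + 1)).mp ?_
    refine (hθ₁ ((θ₁ + 1 : ℝ) : ℂ) (by simp)).congr fun n => ?_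
    rcases eq_or_ne n 0 with rfl | hn
    · simp [hb0]
    · rw [norm_mul, Complex.norm_natCast_cpow_of_pos (Nat.pos_of_ne_zero hn)]
      simp
  have hSanti : ∀ {σ τ : ℝ}, σ ≤ τ → S τ ≤ S σ := fun h =>
    ENNReal.tsum_le_tsum fun m => by
      gcongr
      exact Aux18.v_anti h m
  let Θ : ℝ := max (max (θ₁ + 1) (θ₂ + 1)) (σ₀ + w * (S (θ₁ + 1)).toReal)
  have hkey := Aux18.key c w B Θ
    (Aux18.lsum_of (fun n => B n) Θ (ne_top_of_le_ne_top hS1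
      (hSanti ((le_max_left _ _).trans (le_max_left _ _)))))
    (by
      intro σ hσ
      have h1 : θ₁ + 1 ≤ σ := ((le_max_left _ _).trans (le_max_left _ _)).trans hσ
      have h2 : θ₂ + 1 ≤ σ := ((le_max_right _ _).trans (le_max_left _ _)).trans hσ
      have h3 : σ₀ + w * (S (θ₁ + 1)).toReal ≤ σ := (le_max_right _ _).trans hσ
      have h4 : (S σ).toReal ≤ (S (θ₁ + 1)).toReal := ENNReal.toReal_mono hS1 (hSanti h1)
      refine Aux18.sumT c hcpos hc0 w σ hw B (ne_top_of_le_ne_top hS1 (hSanti h1)) ?_ ?_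
      · refine (Aux18.summ_mono c hcpos hc0 (s := σ₀) ?_ hσ₀').1
        change σ₀ ≤ σ - w * (S σ).toReal
        nlinarith
      · have h5 := hθ₂ (σ : ℂ) (by simp; linarith)
        rw [Aux18.dseries_eq b hb0] at h5
        exact h5)
  have hBn : ∀ m, 0 ≤ B m :=
    Aux18.b_nonneg c hcpos hc0 hc1 w hw B (fun m hm => (hkey m hm).2)
  have hid := Aux18.b_enorm_sum c hcpos w hw B hBn hkey
  refine ⟨fun n => ?_, ?_⟩
  · obtain ⟨h1, h2⟩ := Complex.nonneg_iff.mp (hBn n)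
    exact ⟨(B n).re, h1, Complex.ext (by simp [hB]) (by rw [← hB]; simpa using h2.symm)⟩
  · have hnn : ∀ (r : ℝ) (n : ℕ), 0 ≤ c n * (n : ℝ) ^ (-r) := fun r n => by
      have := hcpos n; positivity
    have hYb : BddBelow {y : ℝ | ∃ s : ℝ, σf < s ∧
        y = s + w * ∑' n : ℕ, c n * (n : ℝ) ^ (-s)} := by
      refine ⟨σf, ?_⟩
      rintro y ⟨s, hs, rfl⟩
      have : 0 ≤ ∑' n : ℕ, c n * (n : ℝ) ^ (-s) := tsum_nonneg (hnn s)
      nlinarith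
    have hlow : ∀ σ ∈ {σ : ℝ | Summable fun n : ℕ => ‖b n‖ * (n : ℝ) ^ (-σ)},
        sInf {y : ℝ | ∃ s : ℝ, σf < s ∧
          y = s + w * ∑' n : ℕ, c n * (n : ℝ) ^ (-s)} ≤ σ := by
      intro σ hσ
      obtain ⟨t, ht, htσ⟩ := Aux18.lower c hcpos hc0 w hw B hBn hid σ
        ((Aux18.summ_iff b hb0 σ).mp hσ)
      have htf : σf ≤ t := by rw [hσf]; exact csInf_le hffin ht
      refine le_of_forall_pos_le_add fun ε hε => ?_
      refine (csInf_le hYb ⟨t + ε, by linarith, rfl⟩).trans ?_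
      have := (Aux18.summ_mono c hcpos hc0 (s := t) (t := t + ε) (by linarith) ht).2
      nlinarith
    rw [hσg]
    apply le_antisymm
    · refine le_csInf ⟨_, σf + 1, by linarith, rfl⟩ ?_
      rintro y ⟨s, hs, rfl⟩
      refine csInf_le ⟨_, hlow⟩ ?_
      rw [hσf] at hs
      obtain ⟨r, hr, hrs⟩ := exists_lt_of_csInf_lt ⟨σ₀, hσ₀⟩ hs
      have hs' := (Aux18.summ_mono c hcpos hc0 hrs.le hr).1
      exact (Aux18.summ_iff b hb0 _).mpr
        (Aux18.upper c hcpos hc0 hc1 w hw B hid s _ hs' le_rfl)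
    · exact le_csInf ⟨θ₁ + 1, (Aux18.summ_iff b hb0 _).mpr hS1⟩ hlow
end
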